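/- Suppose P : ℂ → Prob(C([0,∞),ℂ)) is continuous and defines a Markovian time-changed Brownian motion. Then the invariant measure of P is unique up to a positive multiplicative constant: if μ₁ and μ₂ are non-zero σ-finite Borel measures on ℂ, each invariant for P, then there exists a constant c > 0 such that μ₁ = c·μ₂. -/

import Mathlib

open MeasureTheory ProbabilityTheory Filter Topology
open scoped ENNReal NNReal

noncomputable section

/-- The space `C([0,∞), ℂ)` of continuous paths, with the topology of uniform convergence
on compact time intervals. -/
abbrev PathSp : Type := C(ℝ≥0, ℂ)

instance : MeasurableSpace PathSp := borel PathSp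

instance : BorelSpace PathSp := ⟨rfl⟩

/-- The centered planar Gaussian law on `ℂ` with covariance matrix `v·I₂`. -/
def planarGaussian (v : ℝ≥0) : Measure ℂ :=
  ((gaussianReal 0 v).prod (gaussianReal 0 v)).map fun p => Complex.equivRealProd.symm p

/-- `B` is a standard planar Brownian motion on `(Ω, μ)` started from `z`: it starts at `z`,
has continuous sample paths, and for `s ≤ t` the increment `B_t − B_s` is independent of
`(B_u)_{u ≤ s}` and centered Gaussian with covariance matrix `(t−s)·I₂`. -/
structure IsPlanarBM {Ω : Type*} [MeasurableSpace Ω] (μ : Measure Ω)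
    (B : ℝ≥0 → Ω → ℂ) (z : ℂ) : Prop where
  meas : ∀ t : ℝ≥0, Measurable (B t)
  start : ∀ᵐ ω ∂μ, B 0 ω = z
  cont : ∀ᵐ ω ∂μ, Continuous fun t => B t ω
  indep : ∀ s t : ℝ≥0, s ≤ t →
    Indep (MeasurableSpace.comap (fun ω => B t ω - B s ω) inferInstance)
      (⨆ u ∈ Set.Iic s, MeasurableSpace.comap (B u) inferInstance) μ
  incr : ∀ s t : ℝ≥0, s ≤ t → μ.map (fun ω => B t ω - B s ω) = planarGaussian (t - s)

/-- Shift of a path by time `s`: `(pathShift s X) t = X (s + t)`. -/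
def pathShift (s : ℝ≥0) (X : PathSp) : PathSp :=
  X.comp ⟨fun t => s + t, continuous_add_left s⟩

/-- The σ-algebra on path space generated by the coordinates `(X_u)_{0 ≤ u ≤ s}`. -/
def pastAlg (s : ℝ≥0) : MeasurableSpace PathSp :=
  ⨆ u ∈ Set.Iic s, MeasurableSpace.comap (fun X : PathSp => X u) inferInstance

/-- Each `P_z` is supported on paths starting at `z`. -/
def StartsAt (P : ℂ → ProbabilityMeasure PathSp) : Prop :=
  ∀ z : ℂ, (P z : Measure PathSp) {X : PathSp | X 0 = z} = 1

/-- `P` is Markovian: for each `z` and `s ≥ 0`, the conditional law under `P_z` of the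
shifted path `(X_{s+t})_{t ≥ 0}` given the past `(X_u)_{0 ≤ u ≤ s}` is almost surely
`P_{X_s}`, expressed by integration against events of the past σ-algebra. -/
def IsMarkovian (P : ℂ → ProbabilityMeasure PathSp) : Prop :=
  ∀ (z : ℂ) (s : ℝ≥0) (A : Set PathSp), MeasurableSet[pastAlg s] A →
    ∀ g : PathSp → ℝ, Measurable g → (∃ C : ℝ, ∀ X, |g X| ≤ C) →
      ∫ X in A, g (pathShift s X) ∂(P z : Measure PathSp) =
        ∫ X in A, (∫ Y, g Y ∂(P (X s) : Measure PathSp)) ∂(P z : Measure PathSp)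

/-- `(Ω, μ, B, τ, F)` realizes `ν` as a time-changed Brownian motion started from `z`:
`B` is a planar Brownian motion started at `z`, `τ` is a random continuous strictly
increasing time change with `τ_0 = 0` and `τ_u → ∞`, and the path `u ↦ B_{τ_u}`
(represented by the random continuous path `F`) has law `ν`. -/
def Realizes {Ω : Type} [MeasurableSpace Ω] (μ : Measure Ω) (B : ℝ≥0 → Ω → ℂ)
    (τ : ℝ≥0 → Ω → ℝ≥0) (F : Ω → PathSp) (z : ℂ) (ν : Measure PathSp) : Prop :=
  IsProbabilityMeasure μ ∧ IsPlanarBM μ B z ∧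
  (∀ᵐ ω ∂μ, τ 0 ω = 0 ∧ StrictMono (fun u => τ u ω) ∧
    Continuous (fun u => τ u ω) ∧ Tendsto (fun u => τ u ω) atTop atTop) ∧
  Measurable F ∧ (∀ᵐ ω ∂μ, ∀ u : ℝ≥0, F ω u = B (τ u ω) ω) ∧
  μ.map F = ν

/-- `P` is a time-changed Brownian motion: for each `z`, a process with law `P_z` can be
realized as `X_u = B_{τ_u}` for a planar Brownian motion `B` started from `z` and a random
continuous strictly increasing time change `τ` with `τ_0 = 0` and `τ_u → ∞`. -/
def IsTimeChangedBM (P : ℂ → ProbabilityMeasure PathSp) : Prop :=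
  ∀ z : ℂ, ∃ (Ω : Type) (mΩ : MeasurableSpace Ω) (μ : @Measure Ω mΩ)
    (B : ℝ≥0 → Ω → ℂ) (τ : ℝ≥0 → Ω → ℝ≥0) (F : Ω → PathSp),
      @Realizes Ω mΩ μ B τ F z (P z : Measure PathSp)

/-- `P` defines a Markovian time-changed Brownian motion. -/
def DefinesMTCBM (P : ℂ → ProbabilityMeasure PathSp) : Prop :=
  StartsAt P ∧ IsMarkovian P ∧ IsTimeChangedBM P

/-- The Borel measure `μ` on `ℂ` is invariant for `P`. -/
def InvariantFor (P : ℂ → ProbabilityMeasure PathSp) (μ : Measure ℂ) : Prop :=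
  ∀ (t : ℝ≥0) (A : Set ℂ), MeasurableSet A →
    ∫⁻ z, (P z : Measure PathSp) {X : PathSp | X t ∈ A} ∂μ = μ A

/-! ### The planar Gaussian law -/

lemma measurable_equivRealProd_symm :
    Measurable fun p : ℝ × ℝ => Complex.equivRealProd.symm p :=
  Complex.measurableEquivRealProd.symm.measurable

instance isProbabilityMeasure_planarGaussian (v : ℝ≥0) :
    IsProbabilityMeasure (planarGaussian v) :=
  Measure.isProbabilityMeasure_map measurable_equivRealProd_symm.aemeasurable

lemma charFun_planarGaussian (v : ℝ≥0) (t : ℂ) :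
    charFun (planarGaussian v) t = Complex.exp (-(v * ‖t‖ ^ 2 / 2 : ℝ)) := by
  have h1 : charFun (planarGaussian v) t =
      ∫ p : ℝ × ℝ, Complex.exp (t.re * p.1 * Complex.I) * Complex.exp (t.im * p.2 * Complex.I)
        ∂(gaussianReal 0 v).prod (gaussianReal 0 v) := by
    rw [charFun_apply, planarGaussian, integral_map measurable_equivRealProd_symm.aemeasurable]
    · congr 1
      ext p
      rw [← Complex.exp_add]
      congr 1
      simp [Complex.inner, Complex.equivRealProd, Complex.mul_re]
      ring
    · exact (by fun_prop : Continuous fun x : ℂ =>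
        Complex.exp ((inner ℝ x t : ℝ) * Complex.I)).aestronglyMeasurable
  rw [h1, integral_prod_mul (fun x : ℝ => Complex.exp (t.re * x * Complex.I))
    (fun x : ℝ => Complex.exp (t.im * x * Complex.I)), ← charFun_apply_real,
    ← charFun_apply_real, charFun_gaussianReal, charFun_gaussianReal, ← Complex.exp_add]
  congr 1
  rw [← Complex.normSq_eq_norm_sq, Complex.normSq_apply]
  push_cast
  ring

/-- Planar Gaussian laws are mapped to planar Gaussian laws by linear similarities. -/
lemma planarGaussian_map_smul (v c : ℝ≥0) (ρ : ℂ ≃ₗᵢ[ℝ] ℂ) :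
    (planarGaussian v).map (fun x => (c : ℝ) • ρ x) = planarGaussian (c ^ 2 * v) := by
  have hm : Continuous fun x : ℂ => (c : ℝ) • ρ x := by fun_prop
  have := Measure.isProbabilityMeasure_map (μ := planarGaussian v) hm.aemeasurable
  apply Measure.ext_of_charFun
  ext t
  have : charFun ((planarGaussian v).map fun x => (c : ℝ) • ρ x) t =
      charFun (planarGaussian v) ((c : ℝ) • ρ.symm t) := by
    rw [charFun_apply, charFun_apply, integral_map hm.aemeasurable]
    · congr 1
      ext x
      rw [inner_smul_left, inner_smul_right, ← ρ.inner_map_map x, ρ.apply_symm_apply]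
      rfl
    · exact (by fun_prop : Continuous fun x : ℂ =>
        Complex.exp ((inner ℝ x t : ℝ) * Complex.I)).aestronglyMeasurable
  rw [this, charFun_planarGaussian, charFun_planarGaussian, norm_smul, ρ.symm.norm_map]
  congr 3
  simp
  ring

lemma planarGaussian_conv (a b : ℝ≥0) :
    planarGaussian a ∗ planarGaussian b = planarGaussian (a + b) := by
  apply Measure.ext_of_charFun
  ext t
  rw [charFun_conv, charFun_planarGaussian, charFun_planarGaussian, charFun_planarGaussian,
    ← Complex.exp_add]
  congr 1
  push_cast
  ring

lemma planarGaussian_eq_withDensity {v : ℝ≥0} (hv : v ≠ 0) :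
    planarGaussian v =
      volume.withDensity fun z : ℂ => gaussianPDF 0 v z.re * gaussianPDF 0 v z.im := by
  have hm : Measurable fun z : ℂ => gaussianPDF 0 v z.re * gaussianPDF 0 v z.im :=
    ((measurable_gaussianPDF 0 v).comp Complex.measurable_re).mul
      ((measurable_gaussianPDF 0 v).comp Complex.measurable_im)
  ext s hs
  rw [planarGaussian, Measure.map_apply measurable_equivRealProd_symm hs,
    gaussianReal_of_var_ne_zero 0 hv,
    prod_withDensity (measurable_gaussianPDF 0 v) (measurable_gaussianPDF 0 v),
    withDensity_apply _ (measurable_equivRealProd_symm hs), withDensity_apply _ hs,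
    ← (Complex.volume_preserving_equiv_real_prod.symm).setLIntegral_comp_preimage hs hm]
  rfl

lemma planarGaussian_absolutelyContinuous {v : ℝ≥0} (hv : v ≠ 0) : planarGaussian v ≪ volume := by
  rw [planarGaussian_eq_withDensity hv]
  exact withDensity_absolutelyContinuous _ _

lemma absolutelyContinuous_planarGaussian {v : ℝ≥0} (hv : v ≠ 0) : volume ≪ planarGaussian v := by
  rw [planarGaussian_eq_withDensity hv]
  refine withDensity_absolutelyContinuous' ?_ ?_
  · exact (((measurable_gaussianPDF 0 v).comp Complex.measurable_re).mul
      ((measurable_gaussianPDF 0 v).comp Complex.measurable_im)).aemeasurable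
  · exact .of_forall fun z => mul_ne_zero (gaussianPDF_pos 0 hv _).ne' (gaussianPDF_pos 0 hv _).ne'

/-- The `O(1/n)` lower bound for the heat kernel at time `n` on compact sets. -/
lemma lintegral_planarGaussian_ge (R : ℝ) :
    ∃ c : ℝ, 0 < c ∧ ∀ (n : ℕ) (f : ℂ → ℝ≥0∞),
      ENNReal.ofReal (c / (n + 1)) * ∫⁻ z in Metric.closedBall 0 R, f z ≤
        ∫⁻ z, f z ∂planarGaussian (n + 1) := by
  refine ⟨(2 * Real.pi)⁻¹ * Real.exp (-(R ^ 2) / 2), by positivity, fun n f => ?_⟩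
  have hn : ((n : ℝ≥0) + 1) ≠ 0 := by positivity
  rw [planarGaussian_eq_withDensity hn, lintegral_withDensity_eq_lintegral_mul_non_measurable]
  · rw [← lintegral_const_mul' _ _ ENNReal.ofReal_ne_top]
    refine le_trans ?_ (setLIntegral_le_lintegral (Metric.closedBall 0 R) _)
    refine setLIntegral_mono' measurableSet_closedBall fun z hz => ?_
    refine mul_le_mul_left ?_ (f z)
    simp only [gaussianPDF]
    rw [← ENNReal.ofReal_mul (gaussianPDFReal_nonneg _ _ _)]
    refine ENNReal.ofReal_le_ofReal ?_
    have hz' : ‖z‖ ≤ R := by simpa using hz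
    have h2 : z.re ^ 2 + z.im ^ 2 ≤ R ^ 2 := by
      have := Complex.normSq_eq_norm_sq z
      rw [Complex.normSq_apply] at this
      nlinarith [norm_nonneg z]
    have h3 : gaussianPDFReal 0 ((n : ℝ≥0) + 1) z.re * gaussianPDFReal 0 ((n : ℝ≥0) + 1) z.im =
        (2 * Real.pi * (n + 1))⁻¹ * Real.exp (-(z.re ^ 2 + z.im ^ 2) / (2 * (n + 1))) := by
      have hpos : 0 ≤ 2 * Real.pi * ((n : ℝ) + 1) := by positivity
      simp only [gaussianPDFReal, sub_zero]
      push_cast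
      rw [mul_mul_mul_comm, ← Real.exp_add, ← mul_inv, Real.mul_self_sqrt hpos]
      congr 2
      ring
    rw [h3, mul_inv (2 * Real.pi), div_eq_mul_inv, mul_right_comm]
    refine mul_le_mul_of_nonneg_left (Real.exp_le_exp.2 ?_) (by positivity)
    rw [div_le_div_iff₀ (by norm_num) (by positivity)]
    have : (0 : ℝ) ≤ n := by positivity
    nlinarith [sq_nonneg R, mul_nonneg this (sq_nonneg R)]
  · exact ((measurable_gaussianPDF 0 _).comp Complex.measurable_re).mul
      ((measurable_gaussianPDF 0 _).comp Complex.measurable_im)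
  · exact .of_forall fun z => ENNReal.mul_lt_top gaussianPDF_lt_top gaussianPDF_lt_top

/-! ### Recurrence of the planar Gaussian random walk -/

/-- The probability that a random walk with standard planar Gaussian steps started from `x` avoids
`D` at the times `1, …, m`. -/
def avoidProb (D : Set ℂ) : ℕ → ℂ → ℝ≥0∞
  | 0 => fun _ => 1
  | m + 1 => fun x => ∫⁻ ξ, Dᶜ.indicator (avoidProb D m) (x + ξ) ∂planarGaussian 1

lemma measurable_lintegral_planarGaussian_add {f : ℂ → ℝ≥0∞} (hf : Measurable f) (v : ℝ≥0) :
    Measurable fun x => ∫⁻ ξ, f (x + ξ) ∂planarGaussian v :=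
  (hf.comp measurable_add).lintegral_prod_right'

lemma measurable_avoidProb {D : Set ℂ} (hD : MeasurableSet D) (m : ℕ) :
    Measurable (avoidProb D m) := by
  induction m with
  | zero => exact measurable_const
  | succ m ih => exact measurable_lintegral_planarGaussian_add (ih.indicator hD.compl) 1

lemma avoidProb_succ_le (D : Set ℂ) (m : ℕ) (x : ℂ) : avoidProb D (m + 1) x ≤ avoidProb D m x := by
  induction m generalizing x with
  | zero =>
    calc avoidProb D 1 x ≤ ∫⁻ _, 1 ∂planarGaussian 1 :=
          lintegral_mono fun ξ => Set.indicator_le_self _ _ _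
      _ = avoidProb D 0 x := by simp [avoidProb]
  | succ m ih =>
    exact lintegral_mono fun ξ => Set.indicator_le_indicator (ih _)

lemma ae_eq_zero_of_sum_planarGaussian_le {f : ℂ → ℝ≥0∞} (hf : Measurable f) (x : ℂ)
    (h : ∀ N, ∑ n ∈ Finset.range N, ∫⁻ ξ, f (x + ξ) ∂planarGaussian (n + 1) ≤ 1) :
    f =ᵐ[volume] 0 := by
  have hfx : Measurable fun z => f (x + z) := hf.comp (measurable_const_add x)
  have hball : ∀ R : ℝ, ∫⁻ z in Metric.closedBall (0 : ℂ) R, f (x + z) = 0 := by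
    intro R
    by_contra hI
    obtain ⟨c, hc, hcR⟩ := lintegral_planarGaussian_ge R
    set I := ∫⁻ z in Metric.closedBall (0 : ℂ) R, f (x + z)
    have hsum : (∑' n : ℕ, ENNReal.ofReal (c / (n + 1))) * I ≤ 1 := by
      rw [← ENNReal.tsum_mul_right]
      refine ENNReal.tsum_le_of_sum_range_le fun N => le_trans ?_ (h N)
      exact Finset.sum_le_sum fun n _ => hcR n _
    have hne : ∑' n : ℕ, ENNReal.ofReal (c / (n + 1)) ≠ ∞ := by
      intro htop
      rw [htop, ENNReal.top_mul hI] at hsum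
      simp at hsum
    have hs := ENNReal.summable_toReal hne
    have hs' : Summable fun n : ℕ => 1 / ((n + 1 : ℕ) : ℝ) := by
      refine (hs.mul_left c⁻¹).congr fun n => ?_
      rw [ENNReal.toReal_ofReal (by positivity)]
      push_cast
      field_simp
    exact Real.not_summable_one_div_natCast ((summable_nat_add_iff 1).1 hs')
  have hae : ∀ᵐ z : ℂ, f (x + z) = 0 := by
    have : ∀ n : ℕ, ∀ᵐ z : ℂ, z ∈ Metric.closedBall (0 : ℂ) n → f (x + z) = 0 := by
      intro n
      have := (lintegral_eq_zero_iff hfx).1 (hball n)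
      exact (ae_restrict_iff' measurableSet_closedBall).1 this
    filter_upwards [ae_all_iff.2 this] with z hz
    obtain ⟨n, hn⟩ := exists_nat_ge ‖z‖
    exact hz n (by simpa using hn)
  have h0 : ∫⁻ z, f (x + z) = 0 := by
    rw [lintegral_congr_ae hae]; simp
  rw [lintegral_add_left_eq_self] at h0
  exact (lintegral_eq_zero_iff hf).1 h0

lemma lintegral_planarGaussian_add_eq_zero {f : ℂ → ℝ≥0∞} (hf : Measurable f) (x : ℂ)
    {v : ℝ≥0} (hv : v ≠ 0) :
    ∫⁻ ξ, f (x + ξ) ∂planarGaussian v = 0 ↔ f =ᵐ[volume] 0 := by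
  have hfx : Measurable fun z => f (x + z) := hf.comp (measurable_const_add x)
  rw [lintegral_eq_zero_iff hfx, ← lintegral_eq_zero_iff hf, ← lintegral_add_left_eq_self f x,
    lintegral_eq_zero_iff hfx]
  exact ⟨(absolutelyContinuous_planarGaussian hv).ae_eq,
    (planarGaussian_absolutelyContinuous hv).ae_eq⟩

/-- The planar Gaussian walk is recurrent: it almost surely visits every set of positive area. -/
theorem tendsto_avoidProb {D : Set ℂ} (hD : MeasurableSet D) (hD0 : volume D ≠ 0) (x : ℂ) :
    Tendsto (fun m => avoidProb D m x) atTop (𝓝 0) := by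
  have hadd : ∀ {f : ℂ → ℝ≥0∞}, Measurable f → ∀ x, Measurable fun ξ => f (x + ξ) :=
    fun hf x => hf.comp (measurable_const_add x)
  have hanti : ∀ x, Antitone fun m => avoidProb D m x :=
    fun x => antitone_nat_of_succ_le fun m => avoidProb_succ_le D m x
  set u : ℂ → ℝ≥0∞ := fun x => ⨅ m, avoidProb D m x with hu
  have hum : Measurable u := Measurable.iInf fun m => measurable_avoidProb hD m
  have hu1 : ∀ x, u x ≤ 1 := fun x => iInf_le _ 0
  set g : ℂ → ℝ≥0∞ := D.indicator u with hg
  have hgm : Measurable g := hum.indicator hD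
  have hu_eq : ∀ x, u x = ∫⁻ ξ, Dᶜ.indicator u (x + ξ) ∂planarGaussian 1 := by
    intro x
    have h1 : ∀ ξ, Dᶜ.indicator u (x + ξ) = ⨅ m, Dᶜ.indicator (avoidProb D m) (x + ξ) := by
      intro ξ
      by_cases h : x + ξ ∈ Dᶜ
      · simp [Set.indicator_of_mem h, hu]
      · simp [Set.indicator_of_notMem h]
    simp_rw [h1]
    rw [lintegral_iInf]
    · exact ((hanti x).iInf_nat_add 1).symm
    · exact fun m => ((measurable_avoidProb hD m).indicator hD.compl).comp (measurable_const_add x)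
    · exact fun m n hmn ξ => Set.indicator_le_indicator (hanti _ hmn)
    · have : ∫⁻ ξ, Dᶜ.indicator (avoidProb D 0) (x + ξ) ∂planarGaussian 1 ≤ 1 :=
        avoidProb_succ_le D 0 x
      exact (this.trans_lt ENNReal.one_lt_top).ne
  have hT : ∀ x, ∫⁻ ξ, u (x + ξ) ∂planarGaussian 1 =
      u x + ∫⁻ ξ, g (x + ξ) ∂planarGaussian 1 := by
    intro x
    rw [hu_eq x, ← lintegral_add_right _ (hadd hgm x)]
    congr 1
    ext ξ
    by_cases h : x + ξ ∈ D <;> simp [hg, h]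
  have hconv : ∀ (n : ℕ) {f : ℂ → ℝ≥0∞}, Measurable f → ∀ x,
      ∫⁻ ξ, f (x + ξ) ∂planarGaussian ((n + 1 : ℕ) + 1) =
        ∫⁻ ξ, ∫⁻ ζ, f (x + ξ + ζ) ∂planarGaussian 1 ∂planarGaussian (n + 1) := by
    intro n f hf x
    push_cast
    rw [← planarGaussian_conv ((n : ℝ≥0) + 1) 1,
      Measure.lintegral_conv (hadd hf x)]
    simp [add_assoc]
  have hiter : ∀ (x : ℂ) (N : ℕ), ∫⁻ ξ, u (x + ξ) ∂planarGaussian (N + 1) =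
      u x + ∑ n ∈ Finset.range (N + 1), ∫⁻ ξ, g (x + ξ) ∂planarGaussian (n + 1) := by
    intro x N
    induction N with
    | zero => simpa using hT x
    | succ N ih =>
      rw [hconv N hum, Finset.sum_range_succ, ← add_assoc, ← ih, hconv N hgm]
      simp_rw [hT]
      rw [lintegral_add_left (hadd hum x)]
  have hg0 : g =ᵐ[volume] 0 := by
    refine ae_eq_zero_of_sum_planarGaussian_le hgm x fun N => ?_
    calc ∑ n ∈ Finset.range N, ∫⁻ ξ, g (x + ξ) ∂planarGaussian (n + 1)
        ≤ ∑ n ∈ Finset.range (N + 1), ∫⁻ ξ, g (x + ξ) ∂planarGaussian (n + 1) :=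
          Finset.sum_le_sum_of_subset (Finset.range_mono N.le_succ)
      _ ≤ ∫⁻ ξ, u (x + ξ) ∂planarGaussian (N + 1) := by rw [hiter]; exact le_add_self
      _ ≤ ∫⁻ _, 1 ∂planarGaussian (N + 1) := lintegral_mono fun ξ => hu1 _
      _ = 1 := by simp
  obtain ⟨y, hyD, hy⟩ : ∃ y ∈ D, u y = 0 := by
    by_contra! hne
    refine hD0 (measure_mono_null (fun y hy => ?_) hg0)
    simpa [hg, hy] using hne y hy
  have hTy : ∫⁻ ξ, u (y + ξ) ∂planarGaussian 1 = 0 := by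
    rw [hT, hy, (lintegral_planarGaussian_add_eq_zero hgm y one_ne_zero).2 hg0, add_zero]
  have hu0 := (lintegral_planarGaussian_add_eq_zero hum y one_ne_zero).1 hTy
  have hux : u x = 0 := by
    have := (lintegral_planarGaussian_add_eq_zero hum x one_ne_zero).2 hu0
    rw [hT] at this
    exact (add_eq_zero.1 this).1
  rw [← hux]
  exact tendsto_atTop_iInf (hanti x)

/-! ### Measurability on path space -/

/-- The Borel σ-algebra of path space is generated by the evaluations. -/
lemma measurable_pathSp {α : Type*} [MeasurableSpace α] {f : α → PathSp}
    (hf : ∀ t, Measurable fun a => f a t) : Measurable f := by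
  have hb : borel PathSp = _ :=
    borel_eq_generateFrom_of_subbasis (ContinuousMap.compactOpen_eq (X := ℝ≥0) (Y := ℂ))
  change @Measurable α PathSp _ (borel PathSp) f
  rw [hb]
  refine measurable_generateFrom ?_
  rintro _ ⟨K, hK, U, hU, rfl⟩
  change IsCompact K at hK
  change IsOpen U at hU
  obtain ⟨Q, hQK, hQc, hKQ⟩ :=
    (TopologicalSpace.IsSeparable.of_separableSpace K).exists_countable_dense_subset
  have hset : f ⁻¹' {g : PathSp | Set.MapsTo g K U} =
      ⋃ n : ℕ, ⋂ q ∈ Q, {a | ((n : ℝ≥0∞))⁻¹ ≤ Metric.infEDist (f a q) Uᶜ} := by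
    ext a
    simp only [Set.mem_preimage, Set.mem_ofPred_eq, Set.mem_iUnion, Set.mem_iInter]
    constructor
    · intro h
      rcases K.eq_empty_or_nonempty with rfl | hne
      · exact ⟨0, fun q hq => absurd (hQK hq) (Set.notMem_empty q)⟩
      obtain ⟨x, hxK, hx⟩ := hK.exists_isMinOn hne
        (Metric.continuous_infEDist.comp (f a).continuous :
          Continuous fun q => Metric.infEDist (f a q) Uᶜ).continuousOn
      have hpos : Metric.infEDist (f a x) Uᶜ ≠ 0 := fun h0 =>
        ((Metric.mem_iff_infEDist_zero_of_closed hU.isClosed_compl).2 h0) (h hxK)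
      obtain ⟨n, hn⟩ := ENNReal.exists_inv_nat_lt hpos
      exact ⟨n, fun q hq => hn.le.trans (hx (hQK hq))⟩
    · rintro ⟨n, hn⟩ q hq
      have hcl : IsClosed {q | ((n : ℝ≥0∞))⁻¹ ≤ Metric.infEDist (f a q) Uᶜ} :=
        isClosed_le continuous_const (Metric.continuous_infEDist.comp (f a).continuous)
      have h1 : ((n : ℝ≥0∞))⁻¹ ≤ Metric.infEDist (f a q) Uᶜ :=
        hcl.closure_subset_iff.2 hn (hKQ hq)
      by_contra hqU
      rw [Metric.infEDist_zero_of_mem (show f a q ∈ Uᶜ from hqU)] at h1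
      simp at h1
  rw [hset]
  refine MeasurableSet.iUnion fun n => MeasurableSet.biInter hQc fun q _ => ?_
  exact measurableSet_le measurable_const (Metric.continuous_infEDist.measurable.comp (hf q))

lemma measurable_eval (t : ℝ≥0) : Measurable fun X : PathSp => X t :=
  (continuous_eval_const t).measurable

lemma continuous_pathShift_uncurry :
    Continuous fun p : ℝ≥0 × PathSp => pathShift p.1 p.2 := by
  refine ContinuousMap.continuous_of_continuous_uncurry _ ?_
  change Continuous fun q : (ℝ≥0 × PathSp) × ℝ≥0 => q.1.2 (q.1.1 + q.2)
  fun_prop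

lemma measurable_pathShift (s : ℝ≥0) : Measurable (pathShift s) :=
  (continuous_pathShift_uncurry.comp (Continuous.prodMk_right s)).measurable

@[simp] lemma pathShift_apply (s t : ℝ≥0) (X : PathSp) : pathShift s X t = X (s + t) := rfl

/-- The path stopped at a deterministic time. -/
def stopPath (t : ℝ≥0) (X : PathSp) : PathSp := X.comp ⟨fun s => min s t, by fun_prop⟩

lemma measurable_stopPath (t : ℝ≥0) : @Measurable _ _ (pastAlg t) _ (stopPath t) := by
  refine @measurable_pathSp _ (pastAlg t) _ fun s => ?_
  have h : MeasurableSpace.comap (fun X : PathSp => X (min s t)) inferInstance ≤ pastAlg t :=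
    le_iSup₂ (f := fun (u : ℝ≥0) (_ : u ∈ Set.Iic t) =>
      MeasurableSpace.comap (fun X : PathSp => X u) inferInstance) (min s t) (min_le_right s t)
  exact measurable_iff_comap_le.2 h

lemma pastAlg_le (t : ℝ≥0) : pastAlg t ≤ (inferInstance : MeasurableSpace PathSp) :=
  iSup₂_le fun u _ => (measurable_eval u).comap_le

/-! ### Hitting times of closed sets -/

/-- The set of paths hitting `K` before or at time `t`. -/
def hitsBy (K : Set ℂ) (t : ℝ≥0) : Set PathSp := {X | ∃ s ≤ t, X s ∈ K}

/-- The set of paths hitting `K`. -/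
def hits (K : Set ℂ) : Set PathSp := {X | ∃ s, X s ∈ K}

/-- The hitting time of `K` (with value `0` on paths that do not hit `K`). -/
def hitTime (K : Set ℂ) (X : PathSp) : ℝ≥0 := sInf {t | X t ∈ K}

/-- The position at the hitting time of `K`. -/
def hitPoint (K : Set ℂ) (X : PathSp) : ℂ := X (hitTime K X)

lemma isClosed_hitsBy {K : Set ℂ} (hK : IsClosed K) (t : ℝ≥0) : IsClosed (hitsBy K t) := by
  have h : (hitsBy K t)ᶜ = {X : PathSp | Set.MapsTo X (Set.Icc 0 t) Kᶜ} := by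
    ext X
    simp [hitsBy, Set.MapsTo]
  rw [← isOpen_compl_iff, h]
  exact ContinuousMap.isOpen_setOfPred_mapsTo isCompact_Icc hK.isOpen_compl

lemma measurableSet_hitsBy {K : Set ℂ} (hK : IsClosed K) (t : ℝ≥0) :
    MeasurableSet (hitsBy K t) := (isClosed_hitsBy hK t).measurableSet

lemma measurableSet_pastAlg_hitsBy {K : Set ℂ} (hK : IsClosed K) (t : ℝ≥0) :
    MeasurableSet[pastAlg t] (hitsBy K t) := by
  have h : hitsBy K t = stopPath t ⁻¹' hitsBy K t := by
    ext X
    constructor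
    · rintro ⟨s, hs, hX⟩
      exact ⟨s, hs, by simpa [stopPath, hs] using hX⟩
    · rintro ⟨s, hs, hX⟩
      exact ⟨s, hs, by simpa [stopPath, hs] using hX⟩
  rw [h]
  exact measurable_stopPath t (measurableSet_hitsBy hK t)

lemma hitsBy_mono (K : Set ℂ) {s t : ℝ≥0} (h : s ≤ t) : hitsBy K s ⊆ hitsBy K t :=
  fun _ ⟨r, hr, hX⟩ => ⟨r, hr.trans h, hX⟩

lemma hits_eq_iUnion (K : Set ℂ) : hits K = ⋃ n : ℕ, hitsBy K n := by
  ext X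
  simp only [hits, hitsBy, Set.mem_ofPred_eq, Set.mem_iUnion]
  constructor
  · rintro ⟨s, hs⟩
    obtain ⟨n, hn⟩ := exists_nat_ge s
    exact ⟨n, s, hn, hs⟩
  · rintro ⟨n, s, -, hs⟩
    exact ⟨s, hs⟩

lemma measurableSet_hits {K : Set ℂ} (hK : IsClosed K) : MeasurableSet (hits K) := by
  rw [hits_eq_iUnion]
  exact .iUnion fun n => measurableSet_hitsBy hK n

lemma hitPoint_mem {K : Set ℂ} (hK : IsClosed K) {X : PathSp} (hX : X ∈ hits K) :
    hitPoint K X ∈ K :=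
  (hK.preimage X.continuous).csInf_mem hX (OrderBot.bddBelow _)

lemma hitTime_le_iff {K : Set ℂ} (hK : IsClosed K) {X : PathSp} (hX : X ∈ hits K) (t : ℝ≥0) :
    hitTime K X ≤ t ↔ X ∈ hitsBy K t :=
  ⟨fun h => ⟨_, h, hitPoint_mem hK hX⟩, fun ⟨s, hs, hsK⟩ =>
    (csInf_le' (show s ∈ {t | X t ∈ K} from hsK)).trans hs⟩

lemma measurable_hitTime {K : Set ℂ} (hK : IsClosed K) : Measurable (hitTime K) := by
  refine measurable_of_Iic fun t => ?_
  have h : hitTime K ⁻¹' Set.Iic t = hitsBy K t ∪ (hits K)ᶜ := by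
    ext X
    by_cases hX : X ∈ hits K
    · simpa [hX] using hitTime_le_iff hK hX t
    · have : {t | X t ∈ K} = ∅ := by
        ext s
        exact ⟨fun hs => hX ⟨s, hs⟩, fun hs => hs.elim⟩
      simp [hX, hitTime, this]
  rw [h]
  exact (measurableSet_hitsBy hK t).union (measurableSet_hits hK).compl

lemma measurable_hitPoint {K : Set ℂ} (hK : IsClosed K) : Measurable (hitPoint K) :=
  (continuous_eval.measurable : Measurable fun p : PathSp × ℝ≥0 => p.1 p.2).comp
    (measurable_id.prodMk (measurable_hitTime hK))

lemma measurable_pathShift_hitTime {K : Set ℂ} (hK : IsClosed K) :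
    Measurable fun X => pathShift (hitTime K X) X :=
  continuous_pathShift_uncurry.measurable.comp ((measurable_hitTime hK).prodMk measurable_id)

section TimeChange

variable {τ : ℝ≥0 → ℝ≥0} {F b : PathSp}

lemma surjective_of_timeChange (h0 : τ 0 = 0) (hc : Continuous τ) (hi : Tendsto τ atTop atTop) :
    Function.Surjective τ := fun t =>
  mem_range_of_exists_le_of_exists_ge hc ⟨0, by simp [h0]⟩ (hi.eventually_ge_atTop t).exists

lemma mem_hitsBy_timeChange (K : Set ℂ) (h0 : τ 0 = 0) (hm : StrictMono τ) (hc : Continuous τ)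
    (hi : Tendsto τ atTop atTop) (hF : ∀ u, F u = b (τ u)) (u : ℝ≥0) :
    F ∈ hitsBy K u ↔ b ∈ hitsBy K (τ u) := by
  constructor
  · rintro ⟨s, hs, hX⟩
    exact ⟨τ s, hm.monotone hs, hF s ▸ hX⟩
  · rintro ⟨s, hs, hX⟩
    obtain ⟨r, rfl⟩ := surjective_of_timeChange h0 hc hi s
    exact ⟨r, hm.le_iff_le.1 hs, (hF r).symm ▸ hX⟩

lemma mem_hits_timeChange (K : Set ℂ) (h0 : τ 0 = 0) (hc : Continuous τ)
    (hi : Tendsto τ atTop atTop) (hF : ∀ u, F u = b (τ u)) : F ∈ hits K ↔ b ∈ hits K := by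
  constructor
  · rintro ⟨s, hX⟩
    exact ⟨τ s, hF s ▸ hX⟩
  · rintro ⟨s, hX⟩
    obtain ⟨r, rfl⟩ := surjective_of_timeChange h0 hc hi s
    exact ⟨r, (hF r).symm ▸ hX⟩

lemma hitPoint_timeChange {K : Set ℂ} (hK : IsClosed K) (h0 : τ 0 = 0) (hm : StrictMono τ)
    (hc : Continuous τ) (hi : Tendsto τ atTop atTop) (hF : ∀ u, F u = b (τ u)) (hb : b ∈ hits K) :
    hitPoint K F = hitPoint K b := by
  have hFh := (mem_hits_timeChange K h0 hc hi hF).2 hb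
  have h : τ (hitTime K F) = hitTime K b := by
    apply le_antisymm
    · obtain ⟨r, hr⟩ := surjective_of_timeChange h0 hc hi (hitTime K b)
      rw [← hr]
      refine hm.monotone (csInf_le' ?_)
      change F r ∈ K
      rw [hF, hr]
      exact hitPoint_mem hK hb
    · refine csInf_le' ?_
      change b (τ _) ∈ K
      rw [← hF]
      exact hitPoint_mem hK hFh
  rw [hitPoint, hF, h, hitPoint]

end TimeChange

/-! ### Occupation times -/

/-- The total time spent by a path in `B`. -/
def occupation (B : Set ℂ) (X : PathSp) : ℝ≥0∞ :=
  ∫⁻ t in Set.Ici (0 : ℝ), B.indicator 1 (X t.toNNReal)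

lemma measurable_indicator_eval {B : Set ℂ} (hB : MeasurableSet B) :
    Measurable fun p : PathSp × ℝ => B.indicator (1 : ℂ → ℝ≥0∞) (p.1 p.2.toNNReal) := by
  have h : Continuous fun p : PathSp × ℝ => p.1 p.2.toNNReal := by fun_prop
  exact (measurable_one.indicator hB).comp h.measurable

lemma measurable_occupation {B : Set ℂ} (hB : MeasurableSet B) : Measurable (occupation B) :=
  (measurable_indicator_eval hB).lintegral_prod_right'

lemma occupation_eq_add (B : Set ℂ) (s : ℝ≥0) (X : PathSp) :
    occupation B X = (∫⁻ t in Set.Ico (0 : ℝ) s, B.indicator 1 (X t.toNNReal)) +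
      occupation B (pathShift s X) := by
  have h1 : Set.Ici (0 : ℝ) = Set.Ico (0 : ℝ) s ∪ Set.Ici (s : ℝ) :=
    (Set.Ico_union_Ici_eq_Ici s.2).symm
  have h2 : occupation B (pathShift s X) =
      ∫⁻ t in Set.Ici (s : ℝ), B.indicator 1 (X t.toNNReal) := by
    have := (measurePreserving_add_left (volume : Measure ℝ) (s : ℝ)).setLIntegral_comp_preimage_emb
      (measurableEmbedding_addLeft (s : ℝ)) (fun t => B.indicator 1 (X t.toNNReal))
      (Set.Ici (s : ℝ))
    rw [← this]
    have h3 : (fun t : ℝ => (s : ℝ) + t) ⁻¹' Set.Ici (s : ℝ) = Set.Ici 0 := by ext; simp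
    rw [h3, occupation]
    refine setLIntegral_congr_fun measurableSet_Ici fun t ht => ?_
    rw [pathShift_apply, Real.toNNReal_add s.coe_nonneg ht, Real.toNNReal_coe]
  rw [occupation, h1, lintegral_union measurableSet_Ici, h2]
  rw [Set.disjoint_left]
  exact fun t ht ht' => absurd ht.2 (not_lt.2 ht')

lemma occupation_pathShift_le (B : Set ℂ) (s : ℝ≥0) (X : PathSp) :
    occupation B (pathShift s X) ≤ occupation B X := by
  rw [occupation_eq_add B s X]
  exact le_add_self

lemma occupation_le_add (B : Set ℂ) (s : ℝ≥0) (X : PathSp) :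
    occupation B X ≤ s + occupation B (pathShift s X) := by
  rw [occupation_eq_add B s X]
  gcongr
  calc ∫⁻ t in Set.Ico (0 : ℝ) s, B.indicator 1 (X t.toNNReal)
      ≤ ∫⁻ _ in Set.Ico (0 : ℝ) s, 1 := lintegral_mono fun t => Set.indicator_le_self _ _ _
    _ = s := by simp

lemma occupation_eq_zero_of_pathShift {B : Set ℂ} {X : PathSp}
    (h : ∀ n : ℕ, occupation B (pathShift n X) = occupation B X) (htop : occupation B X ≠ ∞) :
    occupation B X = 0 := by
  have h0 : ∀ n : ℕ, ∫⁻ t in Set.Ico (0 : ℝ) n, B.indicator 1 (X t.toNNReal) = 0 := by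
    intro n
    have := occupation_eq_add B n X
    rw [h n] at this
    exact ((ENNReal.add_left_inj htop).1 (by rw [zero_add]; exact this)).symm
  have h1 : Set.Ici (0 : ℝ) = ⋃ n : ℕ, Set.Ico (0 : ℝ) n := by
    ext t
    simp only [Set.mem_Ici, Set.mem_iUnion, Set.mem_Ico]
    exact ⟨fun ht => (exists_nat_gt t).imp fun n hn => ⟨ht, hn⟩, fun ⟨n, hn⟩ => hn.1⟩
  rw [occupation, h1]
  refine le_antisymm ((lintegral_iUnion_le _ _).trans ?_) zero_le
  simp [h0]

/-! ### Planar Brownian motion -/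

section Brownian

variable {Ω Ω' : Type*} [MeasurableSpace Ω] [MeasurableSpace Ω'] {μ : Measure Ω} {μ' : Measure Ω'}
  {B : ℝ≥0 → Ω → ℂ} {B' : ℝ≥0 → Ω' → ℂ} {z : ℂ}

/-- The σ-algebra generated by a process up to time `a`. -/
abbrev pastOf (B : ℝ≥0 → Ω → ℂ) (a : ℝ≥0) : MeasurableSpace Ω :=
  ⨆ u ∈ Set.Iic a, MeasurableSpace.comap (B u) inferInstance

lemma measurableSet_pastOf (B : ℝ≥0 → Ω → ℂ) {u a : ℝ≥0} (h : u ≤ a) {S : Set ℂ}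
    (hS : MeasurableSet S) : MeasurableSet[pastOf B a] (B u ⁻¹' S) := by
  have h' : MeasurableSpace.comap (B u) inferInstance ≤ pastOf B a :=
    le_iSup₂ (f := fun (u : ℝ≥0) (_ : u ∈ Set.Iic a) =>
      MeasurableSpace.comap (B u) inferInstance) u h
  exact h' _ ⟨S, hS, rfl⟩

lemma measurableSet_pastOf_biInter (B : ℝ≥0 → Ω → ℂ) {I : Finset ℝ≥0} {a : ℝ≥0}
    (hI : ∀ t ∈ I, t ≤ a) {A : ℝ≥0 → Set ℂ} (hA : ∀ t ∈ I, MeasurableSet (A t)) :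
    MeasurableSet[pastOf B a] (⋂ t ∈ I, B t ⁻¹' A t) :=
  Finset.measurableSet_biInter _ fun t ht => measurableSet_pastOf B (hI t ht) (hA t ht)

/-- The Markov property of planar Brownian motion at a deterministic time. -/
lemma IsPlanarBM.setLIntegral_eq [IsProbabilityMeasure μ] (hB : IsPlanarBM μ B z) {a s : ℝ≥0}
    (h : a ≤ s) {E : Set Ω} (hE : MeasurableSet[pastOf B a] E) {f : ℂ → ℝ≥0∞}
    (hf : Measurable f) :
    ∫⁻ ω in E, f (B s ω) ∂μ =
      ∫⁻ ω in E, ∫⁻ ξ, f (B a ω + ξ) ∂planarGaussian (s - a) ∂μ := by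
  have hinc : Measurable fun ω => B s ω - B a ω := (hB.meas s).sub (hB.meas a)
  have hf2 : Measurable fun p : ℂ × ℂ => f (p.1 + p.2) := hf.comp measurable_add
  have hprod : ((μ.restrict E).map (B a)).prod (planarGaussian (s - a)) =
      (μ.restrict E).map fun ω => (B a ω, B s ω - B a ω) := by
    refine Measure.prod_eq fun S T hS hT => ?_
    have hES : MeasurableSet[pastOf B a] (B a ⁻¹' S ∩ E) :=
      (measurableSet_pastOf B le_rfl hS).inter hE
    rw [Measure.map_apply ((hB.meas a).prodMk hinc) (hS.prod hT),
      Measure.restrict_apply (((hB.meas a).prodMk hinc) (hS.prod hT)),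
      Measure.map_apply (hB.meas a) hS, Measure.restrict_apply ((hB.meas a) hS), ← hB.incr a s h,
      Measure.map_apply hinc hT, mul_comm,
      ← (Indep_iff _ _ _).1 (hB.indep a s h) _ _ ⟨T, hT, rfl⟩ hES]
    congr 1
    ext ω
    simp only [Set.mem_inter_iff, Set.mem_preimage, Set.mem_prod]
    tauto
  have h1 : ∫⁻ ω in E, f (B s ω) ∂μ =
      ∫⁻ p, f (p.1 + p.2) ∂(μ.restrict E).map fun ω => (B a ω, B s ω - B a ω) := by
    rw [lintegral_map hf2 ((hB.meas a).prodMk hinc)]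
    simp
  rw [h1, ← hprod, lintegral_prod _ hf2.aemeasurable,
    lintegral_map (measurable_lintegral_planarGaussian_add hf _) (hB.meas a)]

lemma IsPlanarBM.lintegral_zero [IsProbabilityMeasure μ] (hB : IsPlanarBM μ B z)
    (f : ℂ → ℝ≥0∞) : ∫⁻ ω, f (B 0 ω) ∂μ = f z := by
  rw [lintegral_congr_ae (g := fun _ => f z)]
  · simp
  · filter_upwards [hB.start] with ω hω
    rw [hω]

lemma IsPlanarBM.lintegral_eq [IsProbabilityMeasure μ] (hB : IsPlanarBM μ B z) {f : ℂ → ℝ≥0∞}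
    (hf : Measurable f) (s : ℝ≥0) :
    ∫⁻ ω, f (B s ω) ∂μ = ∫⁻ ξ, f (z + ξ) ∂planarGaussian s := by
  have := hB.setLIntegral_eq (zero_le (a := s)) (@MeasurableSet.univ _ (pastOf B 0)) hf
  rw [Measure.restrict_univ,
    hB.lintegral_zero fun x => ∫⁻ ξ, f (x + ξ) ∂planarGaussian (s - 0), tsub_zero] at this
  exact this

/-- The finite-dimensional distributions of planar Brownian motion are determined by the starting
point. -/
lemma IsPlanarBM.setLIntegral_cylinder_eq [IsProbabilityMeasure μ] [IsProbabilityMeasure μ']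
    (hB : IsPlanarBM μ B z) (hB' : IsPlanarBM μ' B' z) {A : ℝ≥0 → Set ℂ} (I : Finset ℝ≥0)
    (hA : ∀ t ∈ I, MeasurableSet (A t)) (s : ℝ≥0) (hs : ∀ t ∈ I, t ≤ s) {f : ℂ → ℝ≥0∞}
    (hf : Measurable f) :
    ∫⁻ ω in ⋂ t ∈ I, B t ⁻¹' A t, f (B s ω) ∂μ =
      ∫⁻ ω in ⋂ t ∈ I, B' t ⁻¹' A t, f (B' s ω) ∂μ' := by
  induction I using Finset.induction_on_max generalizing s f with
  | empty => simp [hB.lintegral_eq hf, hB'.lintegral_eq hf]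
  | insert m I hm ih =>
    have hmA : MeasurableSet (A m) := hA m (Finset.mem_insert_self _ _)
    have hIA : ∀ t ∈ I, MeasurableSet (A t) := fun t ht => hA t (Finset.mem_insert_of_mem ht)
    have hms : m ≤ s := hs m (Finset.mem_insert_self _ _)
    have hg := measurable_lintegral_planarGaussian_add hf (s - m)
    have hI : ∀ t ∈ insert m I, t ≤ m := fun t ht =>
      (Finset.mem_insert.1 ht).elim (fun h => h.le) fun h => (hm t h).le
    rw [hB.setLIntegral_eq hms (measurableSet_pastOf_biInter B hI hA) hf,
      hB'.setLIntegral_eq hms (measurableSet_pastOf_biInter B' hI hA) hf]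
    simp only [Finset.set_biInter_insert]
    rw [← setLIntegral_indicator (hB.meas m hmA), ← setLIntegral_indicator (hB'.meas m hmA)]
    exact ih hIA m (fun t ht => (hm t ht).le) (hg.indicator hmA)

/-- Almost surely continuous processes have measurable realizations on path space. -/
lemma IsPlanarBM.exists_path (hB : IsPlanarBM μ B z) :
    ∃ F : Ω → PathSp, Measurable F ∧ ∀ᵐ ω ∂μ, ∀ t, F ω t = B t ω := by
  classical
  set N := toMeasurable μ {ω | ¬ Continuous fun t => B t ω} with hN
  have hN0 : μ N = 0 := by
    rw [hN, measure_toMeasurable]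
    exact hB.cont
  have hcont : ∀ ω, ω ∉ N → Continuous fun t => B t ω := fun ω hω => by
    by_contra h
    exact hω (subset_toMeasurable μ _ h)
  refine ⟨fun ω => if h : ω ∈ N then 0 else ⟨fun t => B t ω, hcont ω h⟩,
    measurable_pathSp fun t => ?_, ?_⟩
  · have : (fun ω => (if h : ω ∈ N then 0 else ⟨fun t => B t ω, hcont ω h⟩ : PathSp) t) =
        fun ω => if ω ∈ N then 0 else B t ω := by
      ext ω
      by_cases h : ω ∈ N <;> simp [h]
    rw [this]
    exact Measurable.ite (measurableSet_toMeasurable _ _) measurable_const (hB.meas t)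
  · have : ∀ᵐ ω ∂μ, ω ∉ N := measure_eq_zero_iff_ae_notMem.1 hN0
    filter_upwards [this] with ω hω t
    simp [hω]

/-- Uniqueness in law of planar Brownian motion on path space. -/
lemma IsPlanarBM.map_path_eq [IsProbabilityMeasure μ] [IsProbabilityMeasure μ']
    (hB : IsPlanarBM μ B z) (hB' : IsPlanarBM μ' B' z) {F : Ω → PathSp} {F' : Ω' → PathSp}
    (hF : Measurable F) (hF' : Measurable F') (hFB : ∀ᵐ ω ∂μ, ∀ t, F ω t = B t ω)
    (hFB' : ∀ᵐ ω ∂μ', ∀ t, F' ω t = B' t ω) : μ.map F = μ'.map F' := by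
  set m : ℝ≥0 → MeasurableSpace PathSp :=
    fun t => MeasurableSpace.comap (fun X : PathSp => X t) inferInstance with hm
  have hgen : (inferInstance : MeasurableSpace PathSp) =
      MeasurableSpace.generateFrom (piiUnionInter (fun t => {s | MeasurableSet[m t] s}) Set.univ) := by
    refine Eq.trans ?_ (generateFrom_piiUnionInter_measurableSet m Set.univ).symm
    refine le_antisymm ?_ (iSup₂_le fun t _ => (measurable_eval t).comap_le)
    have : @Measurable PathSp PathSp (⨆ i ∈ Set.univ, m i) _ id := by
      refine @measurable_pathSp _ (⨆ i ∈ Set.univ, m i) _ fun t => measurable_iff_comap_le.2 ?_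
      exact le_iSup₂ (f := fun (u : ℝ≥0) (_ : u ∈ Set.univ) => m u) t (Set.mem_univ t)
    intro s hs
    exact this hs
  have := Measure.isProbabilityMeasure_map (μ := μ) hF.aemeasurable
  have := Measure.isProbabilityMeasure_map (μ := μ') hF'.aemeasurable
  refine ext_of_generate_finite _ hgen
    (isPiSystem_piiUnionInter _ (fun t => @MeasurableSpace.isPiSystem_measurableSet _ (m t)) _)
    ?_ (by simp)
  rintro _ ⟨I, -, f, hf, rfl⟩
  choose! A hA hAf using hf
  have hcyl : ⋂ t ∈ I, f t = ⋂ t ∈ I, {X : PathSp | X t ∈ A t} :=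
    Set.iInter₂_congr fun t ht => (hAf t ht).symm
  have hcm : MeasurableSet (⋂ t ∈ I, {X : PathSp | X t ∈ A t}) :=
    Finset.measurableSet_biInter _ fun t ht => measurable_eval t (hA t ht)
  rw [hcyl, Measure.map_apply hF hcm, Measure.map_apply hF' hcm]
  have h1 : μ (F ⁻¹' ⋂ t ∈ I, {X : PathSp | X t ∈ A t}) = μ (⋂ t ∈ I, B t ⁻¹' A t) := by
    refine measure_congr (eventuallyEq_set.2 ?_)
    filter_upwards [hFB] with ω hω
    simp [hω]
  have h2 : μ' (F' ⁻¹' ⋂ t ∈ I, {X : PathSp | X t ∈ A t}) = μ' (⋂ t ∈ I, B' t ⁻¹' A t) := by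
    refine measure_congr (eventuallyEq_set.2 ?_)
    filter_upwards [hFB'] with ω hω
    simp [hω]
  have := hB.setLIntegral_cylinder_eq hB' I hA (I.sup id) (fun t ht => Finset.le_sup (f := id) ht)
    (measurable_const (a := (1 : ℝ≥0∞)))
  rw [h1, h2]
  simpa using this

/-- Scaling, rotation, reflection and translation invariance of planar Brownian motion. -/
lemma IsPlanarBM.similarity (hB : IsPlanarBM μ B z) {φ : ℂ → ℂ} {c k : ℝ≥0} (ρ : ℂ ≃ₗᵢ[ℝ] ℂ)
    (hφ : ∀ v w, φ v - φ w = (c : ℝ) • ρ (v - w)) (hck : c ^ 2 * k = 1) :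
    IsPlanarBM μ (fun t ω => φ (B (k * t) ω)) (φ z) := by
  have hφc : Continuous φ := by
    have : φ = fun v => (c : ℝ) • ρ (v - 0) + φ 0 := by
      ext1 v
      rw [← hφ v 0]
      ring
    rw [this]
    fun_prop
  have hρ : Measurable fun x : ℂ => (c : ℝ) • ρ x :=
    (by fun_prop : Continuous fun x : ℂ => (c : ℝ) • ρ x).measurable
  refine ⟨fun t => hφc.measurable.comp (hB.meas _), ?_, ?_, fun s t hst => ?_, fun s t hst => ?_⟩
  · filter_upwards [hB.start] with ω hω
    rw [mul_zero, hω]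
  · filter_upwards [hB.cont] with ω hω
    exact hφc.comp (hω.comp (continuous_const_mul k))
  · simp only [hφ]
    have h := hB.indep (k * s) (k * t) (mul_le_mul_right hst k)
    refine indep_of_indep_of_le_left (indep_of_indep_of_le_right h ?_) ?_
    · refine iSup₂_le fun u hu => ?_
      refine le_trans ?_ (le_iSup₂ (f := fun (u : ℝ≥0) (_ : u ∈ Set.Iic (k * s)) =>
        MeasurableSpace.comap (B u) inferInstance) (k * u) (mul_le_mul_right hu k))
      rintro _ ⟨S, hS, rfl⟩
      exact ⟨φ ⁻¹' S, hφc.measurable hS, rfl⟩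
    · rintro _ ⟨S, hS, rfl⟩
      exact ⟨_, hρ hS, rfl⟩
  · simp only [hφ]
    have hinc : Measurable fun ω => B (k * t) ω - B (k * s) ω := (hB.meas _).sub (hB.meas _)
    have h : (fun ω => (c : ℝ) • ρ (B (k * t) ω - B (k * s) ω)) =
        (fun x => (c : ℝ) • ρ x) ∘ fun ω => B (k * t) ω - B (k * s) ω := rfl
    rw [h, ← Measure.map_map hρ hinc, hB.incr _ _ (mul_le_mul_right hst k),
      planarGaussian_map_smul, ← mul_tsub, ← mul_assoc, hck, one_mul]

/-- The probability that the Brownian path avoids a set at the times `1, …, M`. -/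
lemma IsPlanarBM.measure_avoid [IsProbabilityMeasure μ] (hB : IsPlanarBM μ B z) {D : Set ℂ}
    (hD : MeasurableSet D) (M : ℕ) :
    μ {ω | ∀ i < M, B ((i : ℝ≥0) + 1) ω ∉ D} = avoidProb D M z := by
  have hE : ∀ M : ℕ, MeasurableSet[pastOf B M] {ω | ∀ i < M, B ((i : ℝ≥0) + 1) ω ∉ D} := by
    intro M
    have : {ω | ∀ i < M, B ((i : ℝ≥0) + 1) ω ∉ D} =
        ⋂ i ∈ Finset.range M, B ((i : ℝ≥0) + 1) ⁻¹' Dᶜ := by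
      ext ω
      simp
    rw [this]
    refine Finset.measurableSet_biInter _ fun i hi => measurableSet_pastOf B ?_ hD.compl
    exact_mod_cast Finset.mem_range.1 hi
  have key : ∀ M k : ℕ, ∫⁻ ω in {ω | ∀ i < M, B ((i : ℝ≥0) + 1) ω ∉ D}, avoidProb D k (B M ω) ∂μ =
      avoidProb D (M + k) z := by
    intro M
    induction M with
    | zero =>
      intro k
      simpa using hB.lintegral_zero (avoidProb D k)
    | succ M ih =>
      intro k
      have hset : {ω | ∀ i < M + 1, B ((i : ℝ≥0) + 1) ω ∉ D} =
          B ((M : ℝ≥0) + 1) ⁻¹' Dᶜ ∩ {ω | ∀ i < M, B ((i : ℝ≥0) + 1) ω ∉ D} := by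
        ext ω
        simp only [Nat.lt_succ_iff_lt_or_eq, Set.mem_ofPred_eq, Set.mem_inter_iff,
          Set.mem_preimage, Set.mem_compl_iff]
        exact ⟨fun h => ⟨h M (Or.inr rfl), fun i hi => h i (Or.inl hi)⟩,
          fun h i hi => hi.elim (h.2 i) fun hi => hi ▸ h.1⟩
      have hm := (measurable_avoidProb hD k).indicator hD.compl
      have h1 := hB.setLIntegral_eq (a := M) (s := (M : ℝ≥0) + 1) (by simp) (hE M) hm
      rw [hset, ← setLIntegral_indicator (hB.meas _ hD.compl)]
      push_cast
      refine Eq.trans ?_ (h1.trans ?_)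
      · rfl
      · rw [show M + 1 + k = M + (k + 1) by ring, ← ih (k + 1)]
        simp [avoidProb]
  have := key M 0
  simpa [avoidProb] using this

lemma IsPlanarBM.ae_hits [IsProbabilityMeasure μ] (hB : IsPlanarBM μ B z) {F : Ω → PathSp}
    (hFB : ∀ᵐ ω ∂μ, ∀ t, F ω t = B t ω) {D : Set ℂ} (hD : MeasurableSet D)
    (hD0 : volume D ≠ 0) : ∀ᵐ ω ∂μ, F ω ∈ hits D := by
  have h1 : ∀ᵐ ω ∂μ, ∃ t, B t ω ∈ D := by
    refine le_antisymm (ge_of_tendsto (tendsto_avoidProb hD hD0 z) ?_) zero_le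
    refine Eventually.of_forall fun M => ?_
    rw [← hB.measure_avoid hD M]
    refine measure_mono fun ω hω i _ hi => hω ⟨_, hi⟩
  filter_upwards [h1, hFB] with ω ⟨t, ht⟩ hω
  exact ⟨t, (hω t).symm ▸ ht⟩

end Brownian

/-! ### Reflection coupling -/

/-- The set of points equidistant from `x` and `y`. -/
def bisector (x y : ℂ) : Set ℂ := {v | ‖v - x‖ = ‖v - y‖}

/-- The set of points closer to `x` than to `y`. -/
def nearer (x y : ℂ) : Set ℂ := {v | ‖v - x‖ ≤ ‖v - y‖}

lemma isClosed_bisector (x y : ℂ) : IsClosed (bisector x y) :=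
  isClosed_eq (by fun_prop) (by fun_prop)

lemma isClosed_nearer (x y : ℂ) : IsClosed (nearer x y) :=
  isClosed_le (by fun_prop) (by fun_prop)

lemma volume_nearer_ne_zero {x y : ℂ} (h : x ≠ y) : volume (nearer x y) ≠ 0 := by
  have hpos : 0 < ‖x - y‖ / 2 := by
    have := norm_sub_pos_iff.2 h
    positivity
  refine ((Metric.measure_ball_pos volume x hpos).trans_le (measure_mono fun v hv => ?_)).ne'
  rw [Metric.mem_ball, dist_eq_norm] at hv
  have h1 : ‖x - y‖ ≤ ‖v - x‖ + ‖v - y‖ := by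
    have := norm_sub_le (v - y) (v - x)
    rwa [sub_sub_sub_cancel_left, add_comm] at this
  change ‖v - x‖ ≤ ‖v - y‖
  linarith

lemma exists_mem_bisector {x y : ℂ} (b : PathSp) {s t T : ℝ≥0} (hs : s ≤ T) (ht : t ≤ T)
    (h1 : b s ∈ nearer x y) (h2 : b t ∈ nearer y x) : b ∈ hitsBy (bisector x y) T := by
  obtain ⟨r, hr, h⟩ := isPreconnected_Icc.intermediate_value₂ (s := Set.Icc 0 T)
    ⟨zero_le, hs⟩ ⟨zero_le, ht⟩ (f := fun r => ‖b r - x‖) (g := fun r => ‖b r - y‖)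
    (by fun_prop) (by fun_prop) h1 h2
  exact ⟨r, hr.2, h⟩

/-- There is an affine reflection exchanging `x` and `y` and fixing their bisector. -/
lemma exists_reflection (x y : ℂ) : ∃ (R : ℂ → ℂ) (ρ : ℂ ≃ₗᵢ[ℝ] ℂ),
    (∀ v w, R v - R w = ρ (v - w)) ∧ R x = y ∧ (∀ v ∈ bisector x y, R v = v) ∧
      ∀ v, R v ∈ bisector x y ↔ v ∈ bisector x y := by
  set m : ℂ := (x + y) / 2 with hm
  have hxm : x - m = (x - y) / 2 := by rw [hm]; ring
  have hym : y - m = -((x - y) / 2) := by rw [hm]; ring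
  set ρ : ℂ ≃ₗᵢ[ℝ] ℂ := Submodule.reflection (Submodule.span ℝ {(x - m) - (y - m)})ᗮ with hρ
  have hnorm : ‖x - m‖ = ‖y - m‖ := by rw [hxm, hym, norm_neg]
  have hρx : ρ (x - m) = y - m := Submodule.reflection_sub hnorm
  have hρy : ρ (y - m) = x - m := by
    rw [← hρx, hρ]
    exact Submodule.reflection_reflection _ _
  have hR : ∀ v w, (ρ (v - m) + m) - (ρ (w - m) + m) = ρ (v - w) := fun v w => by
    rw [add_sub_add_right_eq_sub, ← map_sub, sub_sub_sub_cancel_right]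
  refine ⟨fun v => ρ (v - m) + m, ρ, hR, ?_, fun v hv => ?_, fun v => ?_⟩
  · simp [hρx]
  · have : v - m ∈ (Submodule.span ℝ {(x - m) - (y - m)})ᗮ := by
      rw [Submodule.mem_orthogonal_singleton_iff_inner_left]
      have h := (real_inner_add_sub_eq_zero_iff (v - x) (v - y)).2 hv
      have e1 : (v - x) + (v - y) = (2 : ℝ) • (v - m) := by
        rw [hm, Complex.real_smul]
        push_cast
        ring
      have e2 : (v - x) - (v - y) = -((x - m) - (y - m)) := by ring
      rw [e1, e2, real_inner_smul_left, inner_neg_right] at h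
      linarith
    have h2 : ρ (v - m) = v - m := Submodule.reflection_mem_subspace_eq_self this
    simp only [h2, sub_add_cancel]
  · have e1 : ‖(ρ (v - m) + m) - x‖ = ‖v - y‖ := by
      have : x = ρ (y - m) + m := by rw [hρy]; ring
      conv_lhs => rw [this]
      rw [hR, LinearIsometryEquiv.norm_map]
    have e2 : ‖(ρ (v - m) + m) - y‖ = ‖v - x‖ := by
      have : y = ρ (x - m) + m := by rw [hρx]; ring
      conv_lhs => rw [this]
      rw [hR, LinearIsometryEquiv.norm_map]
    change ‖(ρ (v - m) + m) - x‖ = ‖(ρ (v - m) + m) - y‖ ↔ ‖v - x‖ = ‖v - y‖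
    rw [e1, e2]
    exact eq_comm

section Brownian

variable {Ω Ω' : Type*} [MeasurableSpace Ω] [MeasurableSpace Ω'] {μ : Measure Ω} {μ' : Measure Ω'}
  {B : ℝ≥0 → Ω → ℂ} {B' : ℝ≥0 → Ω' → ℂ} {x y : ℂ}

lemma IsPlanarBM.ae_hits_bisector [IsProbabilityMeasure μ] {z : ℂ} (hB : IsPlanarBM μ B z)
    {F : Ω → PathSp} (hFB : ∀ᵐ ω ∂μ, ∀ t, F ω t = B t ω) (hxy : x ≠ y) :
    ∀ᵐ ω ∂μ, F ω ∈ hits (bisector x y) := by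
  filter_upwards [hB.ae_hits hFB (isClosed_nearer x y).measurableSet (volume_nearer_ne_zero hxy),
    hB.ae_hits hFB (isClosed_nearer y x).measurableSet (volume_nearer_ne_zero hxy.symm)]
    with ω ⟨s, hs⟩ ⟨t, ht⟩
  obtain ⟨r, -, hr⟩ := exists_mem_bisector (F ω) (le_max_left s t) (le_max_right s t) hs ht
  exact ⟨r, hr⟩

/-- Brownian motions started at `x` and `y` hit the bisector at the same law. -/
lemma IsPlanarBM.map_hitPoint_bisector_eq [IsProbabilityMeasure μ] [IsProbabilityMeasure μ']
    (hB : IsPlanarBM μ B x) (hB' : IsPlanarBM μ' B' y) {F : Ω → PathSp} {F' : Ω' → PathSp}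
    (hF : Measurable F) (hF' : Measurable F') (hFB : ∀ᵐ ω ∂μ, ∀ t, F ω t = B t ω)
    (hFB' : ∀ᵐ ω ∂μ', ∀ t, F' ω t = B' t ω) (hxy : x ≠ y) :
    μ.map (fun ω => hitPoint (bisector x y) (F ω)) =
      μ'.map (fun ω => hitPoint (bisector x y) (F' ω)) := by
  obtain ⟨R, ρ, hRρ, hRx, hRL, hRmem⟩ := exists_reflection x y
  have hRc : Continuous R := by
    have : R = fun v => ρ (v - 0) + R 0 := by
      ext1 v
      rw [← hRρ v 0]
      ring
    rw [this]
    fun_prop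
  have hRB : IsPlanarBM μ (fun t ω => R (B (1 * t) ω)) (R x) :=
    hB.similarity (c := 1) (k := 1) ρ (by simpa using hRρ) (by simp)
  rw [hRx] at hRB
  set G : Ω → PathSp := fun ω => (ContinuousMap.mk R hRc).comp (F ω) with hG
  have hGm : Measurable G := measurable_pathSp fun t =>
    hRc.measurable.comp ((measurable_eval t).comp hF)
  have hGB : ∀ᵐ ω ∂μ, ∀ t, G ω t = R (B (1 * t) ω) := by
    filter_upwards [hFB] with ω hω t
    simp [hG, hω]
  have hL := isClosed_bisector x y
  have hlaw := hRB.map_path_eq hB' hGm hF' hGB hFB'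
  have h1 : μ.map (fun ω => hitPoint (bisector x y) (F ω)) =
      μ.map (fun ω => hitPoint (bisector x y) (G ω)) := by
    refine Measure.map_congr ?_
    filter_upwards [hB.ae_hits_bisector hFB hxy] with ω hω
    have ht : hitTime (bisector x y) (G ω) = hitTime (bisector x y) (F ω) := by
      simp [hitTime, hG, hRmem]
    rw [hitPoint, hitPoint, ht]
    exact (hRL _ (hitPoint_mem hL hω)).symm
  rw [h1]
  change μ.map (hitPoint (bisector x y) ∘ G) = μ'.map (hitPoint (bisector x y) ∘ F')
  rw [← Measure.map_map (measurable_hitPoint hL) hGm, hlaw,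
    Measure.map_map (measurable_hitPoint hL) hF']

/-- Brownian motion started at `y` quickly hits the bisector with a nearby point. -/
lemma IsPlanarBM.measure_not_hitsBy_bisector_le [IsProbabilityMeasure μ]
    (hB : IsPlanarBM μ B y) {F : Ω → PathSp} (hFB : ∀ᵐ ω ∂μ, ∀ t, F ω t = B t ω) (hxy : x ≠ y)
    (M : ℕ) {δ : ℝ≥0} (hδ : M * ‖x - y‖₊ ^ 2 ≤ δ) :
    μ {ω | F ω ∉ hitsBy (bisector x y) δ} ≤ avoidProb (nearer 1 0) M 0 := by
  set d : ℝ≥0 := ‖x - y‖₊ with hd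
  have hd0 : d ≠ 0 := by simpa [hd, sub_eq_zero] using hxy
  have hdR : (d : ℝ) ≠ 0 := by exact_mod_cast hd0
  have hdn : ‖x - y‖ = d := rfl
  have hxy' : x - y ≠ 0 := sub_ne_zero.2 hxy
  set u : Circle := ⟨d / (x - y), by simp [Submonoid.unitSphere, hdn, hd0]⟩ with hu
  have hφ : ∀ v w : ℂ, (v - y) / (x - y) - (w - y) / (x - y) =
      ((d⁻¹ : ℝ≥0) : ℝ) • rotation u (v - w) := by
    intro v w
    have : (d : ℂ) ≠ 0 := by exact_mod_cast hdR
    rw [rotation_apply, Complex.real_smul, hu]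
    push_cast
    field_simp
    ring
  have hB' := hB.similarity (k := d ^ 2) (rotation u) hφ
    (by rw [← mul_pow, inv_mul_cancel₀ hd0, one_pow])
  rw [sub_self, zero_div] at hB'
  rw [← hB'.measure_avoid (isClosed_nearer 1 0).measurableSet M]
  refine measure_mono_ae ?_
  filter_upwards [hFB, hB.start] with ω hω h0 hm i hi hmem
  refine hm ?_
  have ht : d ^ 2 * ((i : ℝ≥0) + 1) ≤ δ := by
    refine le_trans ?_ hδ
    rw [mul_comm]
    gcongr
    exact_mod_cast hi
  refine exists_mem_bisector (F ω) ht zero_le ?_ ?_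
  · rw [hω]
    set v := B (d ^ 2 * ((i : ℝ≥0) + 1)) ω
    change ‖(v - y) / (x - y) - 1‖ ≤ ‖(v - y) / (x - y) - 0‖ at hmem
    change ‖v - x‖ ≤ ‖v - y‖
    have e : (v - y) / (x - y) - 1 = (v - x) / (x - y) := by
      field_simp
      ring
    rwa [e, sub_zero, norm_div, norm_div, div_le_div_iff_of_pos_right (by positivity)] at hmem
  · rw [hω, h0]
    simp [nearer]

end Brownian

/-! ### Consequences for time-changed Brownian motions -/

/-- A time-changed Brownian motion together with a realization of the Brownian path. -/
lemma IsTimeChangedBM.exists_realization {P : ℂ → ProbabilityMeasure PathSp}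
    (hP : IsTimeChangedBM P) (z : ℂ) :
    ∃ (Ω : Type) (_ : MeasurableSpace Ω) (μ : Measure Ω) (B : ℝ≥0 → Ω → ℂ) (τ : ℝ≥0 → Ω → ℝ≥0)
      (F b : Ω → PathSp), IsProbabilityMeasure μ ∧ IsPlanarBM μ B z ∧ Measurable F ∧
        Measurable b ∧ (∀ᵐ ω ∂μ, ∀ t, b ω t = B t ω) ∧ μ.map F = P z ∧
        ∀ᵐ ω ∂μ, τ 0 ω = 0 ∧ StrictMono (fun u => τ u ω) ∧ Continuous (fun u => τ u ω) ∧
          Tendsto (fun u => τ u ω) atTop atTop ∧ ∀ u, F ω u = b ω (τ u ω) := by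
  obtain ⟨Ω, mΩ, μ, B, τ, F, hμ, hB, hτ, hF, hFB, hlaw⟩ := hP z
  obtain ⟨b, hb, hbB⟩ := hB.exists_path
  refine ⟨Ω, mΩ, μ, B, τ, F, b, hμ, hB, hF, hb, hbB, hlaw, ?_⟩
  filter_upwards [hτ, hFB, hbB] with ω ⟨h0, hm, hc, hi⟩ hω hω'
  exact ⟨h0, hm, hc, hi, fun u => by rw [hω, hω']⟩

section TimeChanged

variable {P : ℂ → ProbabilityMeasure PathSp}

lemma IsTimeChangedBM.ae_hits (hP : IsTimeChangedBM P) (z : ℂ) {D : Set ℂ} (hD : IsClosed D)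
    (hD0 : volume D ≠ 0) : ∀ᵐ X ∂(P z : Measure PathSp), X ∈ hits D := by
  obtain ⟨Ω, mΩ, μ, B, τ, F, b, hμ, hB, hF, hb, hbB, hlaw, hτ⟩ := hP.exists_realization z
  rw [← hlaw]
  refine (ae_map_iff (p := fun X => X ∈ hits D) hF.aemeasurable (measurableSet_hits hD)).2 ?_
  filter_upwards [hτ, hB.ae_hits hbB hD.measurableSet hD0] with ω ⟨h0, hm, hc, hi, h⟩ hω
  exact (mem_hits_timeChange D h0 hc hi h).2 hω

lemma IsTimeChangedBM.ae_hits_bisector (hP : IsTimeChangedBM P) (z : ℂ) {x y : ℂ} (hxy : x ≠ y) :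
    ∀ᵐ X ∂(P z : Measure PathSp), X ∈ hits (bisector x y) := by
  obtain ⟨Ω, mΩ, μ, B, τ, F, b, hμ, hB, hF, hb, hbB, hlaw, hτ⟩ := hP.exists_realization z
  rw [← hlaw]
  refine (ae_map_iff (p := fun X => X ∈ hits (bisector x y)) hF.aemeasurable
    (measurableSet_hits (isClosed_bisector x y))).2 ?_
  filter_upwards [hτ, hB.ae_hits_bisector hbB hxy] with ω ⟨h0, hm, hc, hi, h⟩ hω
  exact (mem_hits_timeChange _ h0 hc hi h).2 hω

lemma IsTimeChangedBM.map_hitPoint_bisector_eq (hP : IsTimeChangedBM P) {x y : ℂ} (hxy : x ≠ y) :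
    (P x : Measure PathSp).map (hitPoint (bisector x y)) =
      (P y : Measure PathSp).map (hitPoint (bisector x y)) := by
  obtain ⟨Ω, mΩ, μ, B, τ, F, b, hμ, hB, hF, hb, hbB, hlaw, hτ⟩ := hP.exists_realization x
  obtain ⟨Ω', mΩ', μ', B', τ', F', b', hμ', hB', hF', hb', hbB', hlaw', hτ'⟩ :=
    hP.exists_realization y
  have hL := isClosed_bisector x y
  have h1 : μ.map (hitPoint (bisector x y) ∘ F) = μ.map (fun ω => hitPoint (bisector x y) (b ω)) := by
    refine Measure.map_congr ?_
    filter_upwards [hτ, hB.ae_hits_bisector hbB hxy] with ω ⟨h0, hm, hc, hi, h⟩ hω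
    exact hitPoint_timeChange hL h0 hm hc hi h hω
  have h2 : μ'.map (hitPoint (bisector x y) ∘ F') =
      μ'.map (fun ω => hitPoint (bisector x y) (b' ω)) := by
    refine Measure.map_congr ?_
    filter_upwards [hτ', hB'.ae_hits_bisector hbB' hxy] with ω ⟨h0, hm, hc, hi, h⟩ hω
    exact hitPoint_timeChange hL h0 hm hc hi h hω
  rw [← hlaw, ← hlaw', Measure.map_map (measurable_hitPoint hL) hF,
    Measure.map_map (measurable_hitPoint hL) hF', h1, h2]
  exact hB.map_hitPoint_bisector_eq hB' hb hb' hbB hbB' hxy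

/-- A time-changed Brownian motion started at `y` quickly hits the bisector with a nearby point. -/
lemma IsTimeChangedBM.exists_measure_compl_hitsBy_bisector_le (hP : IsTimeChangedBM P) (y : ℂ)
    {ε : ℝ≥0} (hε : 0 < ε) {η : ℝ≥0∞} (hη : 0 < η) :
    ∃ r : ℝ, 0 < r ∧ ∀ x, x ≠ y → dist x y < r →
      (P y : Measure PathSp) (hitsBy (bisector x y) ε)ᶜ ≤ η := by
  obtain ⟨Ω, mΩ, μ, B, τ, F, b, hμ, hB, hF, hb, hbB, hlaw, hτ⟩ := hP.exists_realization y
  have hη2 : 0 < η / 2 := ENNReal.half_pos hη.ne'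
  obtain ⟨M, hM⟩ := ((tendsto_avoidProb (isClosed_nearer 1 0).measurableSet
    (volume_nearer_ne_zero one_ne_zero) 0).eventually_le_const hη2).exists
  have hδ : ∃ n : ℕ, 1 - η / 2 ≤ μ {ω | ((n : ℝ≥0) + 1)⁻¹ ≤ τ ε ω} := by
    have hmono : Monotone fun n : ℕ => {ω | ((n : ℝ≥0) + 1)⁻¹ ≤ τ ε ω} := by
      intro m n hmn ω hω
      change ((m : ℝ≥0) + 1)⁻¹ ≤ τ ε ω at hω
      change ((n : ℝ≥0) + 1)⁻¹ ≤ τ ε ω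
      refine le_trans ?_ hω
      gcongr
    have hlim := tendsto_measure_iUnion_atTop (μ := μ) hmono
    have hone : μ (⋃ n : ℕ, {ω | ((n : ℝ≥0) + 1)⁻¹ ≤ τ ε ω}) = 1 := by
      refine le_antisymm prob_le_one ?_
      rw [← measure_univ (μ := μ)]
      refine measure_mono_ae ?_
      filter_upwards [hτ] with ω ⟨h0, hm, _⟩ _
      have hpos : 0 < τ ε ω := h0 ▸ hm hε
      obtain ⟨n, hn⟩ := exists_nat_ge (τ ε ω)⁻¹
      refine Set.mem_iUnion.2 ⟨n, ?_⟩
      change ((n : ℝ≥0) + 1)⁻¹ ≤ τ ε ω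
      exact inv_le_of_inv_le₀ hpos (hn.trans (by simp))
    rw [hone] at hlim
    by_cases h2 : η / 2 = ∞
    · exact ⟨0, by simp [h2]⟩
    · have : 1 - η / 2 < 1 := ENNReal.sub_lt_self (by simp) (by simp) hη2.ne'
      obtain ⟨n, hn⟩ := (hlim.eventually_const_le this).exists
      exact ⟨n, hn⟩
  obtain ⟨n, hn⟩ := hδ
  set δ : ℝ≥0 := ((n : ℝ≥0) + 1)⁻¹ with hδdef
  have hδpos : 0 < δ := by positivity
  have hcont : ∀ᶠ x in 𝓝 y, (M : ℝ≥0) * ‖x - y‖₊ ^ 2 < δ := by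
    have : Tendsto (fun x => (M : ℝ≥0) * ‖x - y‖₊ ^ 2) (𝓝 y) (𝓝 (M * ‖y - y‖₊ ^ 2)) :=
      (by fun_prop : Continuous fun x => (M : ℝ≥0) * ‖x - y‖₊ ^ 2).tendsto y
    refine this.eventually_lt_const ?_
    simpa using hδpos
  obtain ⟨r, hr, hball⟩ := Metric.eventually_nhds_iff.1 hcont
  refine ⟨r, hr, fun x hx hxr => ?_⟩
  have hL := isClosed_bisector x y
  have hmiss := (hB.measure_not_hitsBy_bisector_le hbB hx M (hball hxr).le).trans hM
  have hmeas : MeasurableSet (hitsBy (bisector x y) ε) := measurableSet_hitsBy hL ε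
  have hge : 1 - η / 2 ≤ μ (F ⁻¹' hitsBy (bisector x y) ε) + η / 2 := by
    refine hn.trans (le_trans ?_ (add_le_add_right hmiss _))
    refine le_trans (measure_mono_ae ?_) (measure_union_le _ _)
    filter_upwards [hτ] with ω ⟨h0, hm, hc, hi, h⟩ hω
    by_cases hbω : b ω ∈ hitsBy (bisector x y) δ
    · exact Or.inl ((mem_hitsBy_timeChange _ h0 hm hc hi h ε).2 (hitsBy_mono _ hω hbω))
    · exact Or.inr hbω
  have := Measure.isProbabilityMeasure_map (μ := μ) hF.aemeasurable
  rw [← hlaw, prob_compl_eq_one_sub hmeas, Measure.map_apply hF hmeas]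
  rw [tsub_le_iff_right] at hge ⊢
  calc 1 ≤ _ := hge
    _ = η + _ := by rw [add_assoc, ENNReal.add_halves, add_comm]

end TimeChanged

/-! ### The strong Markov property at hitting times -/

section Markov

variable {P : ℂ → ProbabilityMeasure PathSp}

lemma measurable_coe_of_continuous (hPc : Continuous P) :
    Measurable fun z => (P z : Measure PathSp) := by
  refine Measurable.measure_of_isPiSystem_of_isProbabilityMeasure
    rfl isPiSystem_isOpen fun U hU => ?_
  refine LowerSemicontinuous.measurable (lowerSemicontinuous_iff_le_liminf.2 fun z => ?_)
  exact ProbabilityMeasure.le_liminf_measure_open_of_tendsto (hPc.tendsto z) hU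

lemma continuous_lintegral (hPc : Continuous P) (g : BoundedContinuousFunction PathSp ℝ≥0) :
    Continuous fun z => ∫⁻ X, g X ∂(P z : Measure PathSp) :=
  continuous_iff_continuousAt.2 fun z =>
    ProbabilityMeasure.tendsto_iff_forall_lintegral_tendsto.1 (hPc.tendsto z) g

lemma measurable_lintegral (hPc : Continuous P) {f : PathSp → ℝ≥0∞} (hf : Measurable f) :
    Measurable fun z => ∫⁻ X, f X ∂(P z : Measure PathSp) :=
  (Measure.measurable_lintegral hf).comp (measurable_coe_of_continuous hPc)

/-- The Markov property for non-negative functionals. -/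
lemma IsMarkovian.setLIntegral_eq (hPc : Continuous P) (hP : IsMarkovian P) (z : ℂ) (s : ℝ≥0)
    {A : Set PathSp} (hA : MeasurableSet[pastAlg s] A) {f : PathSp → ℝ≥0∞} (hf : Measurable f) :
    ∫⁻ X in A, f (pathShift s X) ∂(P z : Measure PathSp) =
      ∫⁻ X in A, ∫⁻ Y, f Y ∂(P (X s) : Measure PathSp) ∂(P z : Measure PathSp) := by
  have hk := measurable_coe_of_continuous hPc
  have hks : Measurable fun X : PathSp => (P (X s) : Measure PathSp) := hk.comp (measurable_eval s)
  have hmeas : ((P z : Measure PathSp).restrict A).map (pathShift s) =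
      ((P z : Measure PathSp).restrict A).bind fun X => (P (X s) : Measure PathSp) := by
    ext S hS
    rw [Measure.map_apply (measurable_pathShift s) hS, Measure.bind_apply hS hks.aemeasurable]
    have h := hP z s A hA (S.indicator fun _ => 1) (measurable_const.indicator hS)
      ⟨1, fun X => by by_cases hX : X ∈ S <;> simp [hX]⟩
    have h1 : (fun X => S.indicator (fun _ => (1 : ℝ)) (pathShift s X)) =
        (pathShift s ⁻¹' S).indicator fun _ => 1 := rfl
    rw [h1, integral_indicator_const _ (measurable_pathShift s hS)] at h
    simp only [integral_indicator_const _ hS, smul_eq_mul, mul_one] at h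
    have hm : Measurable fun X : PathSp => (P (X s) : Measure PathSp).real S :=
      ((Measure.measurable_coe hS).comp hks).ennreal_toReal
    have h2 : ENNReal.ofReal (∫ X in A, (P (X s) : Measure PathSp).real S ∂(P z : Measure PathSp)) =
        ∫⁻ X in A, (P (X s) : Measure PathSp) S ∂(P z : Measure PathSp) := by
      rw [ofReal_integral_eq_lintegral_ofReal]
      · exact lintegral_congr fun X => by
          rw [Measure.real, ENNReal.ofReal_toReal (measure_ne_top _ _)]
      · refine Integrable.of_bound hm.aestronglyMeasurable 1 (ae_of_all _ fun X => ?_)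
        rw [Real.norm_of_nonneg measureReal_nonneg]
        exact measureReal_le_one
      · exact ae_of_all _ fun X => measureReal_nonneg
    rw [← h2, ← h, Measure.real, ENNReal.ofReal_toReal (measure_ne_top _ _)]
  rw [← lintegral_map hf (measurable_pathShift s), hmeas,
    Measure.lintegral_bind hks.aemeasurable hf.aemeasurable]

/-- The `n`-th dyadic-type upper approximation of the hitting time. -/
def discTime (K : Set ℂ) (n : ℕ) (X : PathSp) : ℝ≥0 := ⌈((n : ℝ≥0) + 1) * hitTime K X⌉₊ / (n + 1)

lemma tendsto_discTime (K : Set ℂ) (X : PathSp) :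
    Tendsto (fun n => discTime K n X) atTop (𝓝 (hitTime K X)) := by
  have hlim : Tendsto (fun n : ℕ => hitTime K X + ((n : ℝ≥0) + 1)⁻¹) atTop (𝓝 (hitTime K X)) := by
    have h1 : Tendsto (fun n : ℕ => ((n : ℝ≥0) + 1)⁻¹) atTop (𝓝 0) := by
      have := tendsto_inv_atTop_nhds_zero_nat (𝕜 := ℝ≥0)
      have := (tendsto_add_atTop_iff_nat 1).2 this
      simpa using this
    simpa using h1.const_add (hitTime K X)
  refine tendsto_of_tendsto_of_tendsto_of_le_of_le tendsto_const_nhds hlim (fun n => ?_)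
    fun n => ?_
  · have hn : (0 : ℝ≥0) < (n : ℝ≥0) + 1 := by positivity
    change hitTime K X ≤ _ / _
    rw [le_div_iff₀ hn, mul_comm]
    exact Nat.le_ceil _
  · have hn : (0 : ℝ≥0) < (n : ℝ≥0) + 1 := by positivity
    change _ / _ ≤ _
    rw [div_le_iff₀ hn, add_mul (hitTime K X), inv_mul_cancel₀ hn.ne', mul_comm (hitTime K X)]
    exact (Nat.ceil_lt_add_one zero_le).le

/-- The strong Markov property at the hitting time of a closed set. -/
theorem IsMarkovian.lintegral_pathShift_hitTime (hPc : Continuous P) (hP : IsMarkovian P) {z : ℂ}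
    {K : Set ℂ} (hK : IsClosed K) (hhit : ∀ᵐ X ∂(P z : Measure PathSp), X ∈ hits K)
    {f : PathSp → ℝ≥0∞} (hf : Measurable f) :
    ∫⁻ X, f (pathShift (hitTime K X) X) ∂(P z : Measure PathSp) =
      ∫⁻ X, ∫⁻ Y, f Y ∂(P (hitPoint K X) : Measure PathSp) ∂(P z : Measure PathSp) := by
  have hk := measurable_coe_of_continuous hPc
  have hkh : Measurable fun X : PathSp => (P (hitPoint K X) : Measure PathSp) :=
    hk.comp (measurable_hitPoint hK)
  have hsh := measurable_pathShift_hitTime hK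
  have := Measure.isProbabilityMeasure_map (μ := (P z : Measure PathSp)) hsh.aemeasurable
  have hdisc : ∀ n, Measurable (discTime K n) := fun n => by
    have h1 : Measurable fun X => ⌈((n : ℝ≥0) + 1) * hitTime K X⌉₊ :=
      Nat.measurable_ceil.comp ((measurable_hitTime hK).const_mul _)
    exact ((measurable_from_nat (f := fun k : ℕ => (k : ℝ≥0))).comp h1).div_const _
  suffices hmeas : (P z : Measure PathSp).map (fun X => pathShift (hitTime K X) X) =
      (P z : Measure PathSp).bind fun X => (P (hitPoint K X) : Measure PathSp) by
    rw [← lintegral_map hf hsh, hmeas, Measure.lintegral_bind hkh.aemeasurable hf.aemeasurable]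
  refine ext_of_forall_lintegral_eq_of_IsFiniteMeasure fun g => ?_
  have hg : Measurable fun X => (g X : ℝ≥0∞) := g.continuous.measurable.coe_nnreal_ennreal
  rw [lintegral_map hg hsh, Measure.lintegral_bind hkh.aemeasurable hg.aemeasurable]
  set G : ℂ → ℝ≥0∞ := fun x => ∫⁻ Y, g Y ∂(P x : Measure PathSp) with hG
  have hGc : Continuous G := continuous_lintegral hPc g
  obtain ⟨C, hC⟩ : ∃ C : ℝ≥0, ∀ X, g X ≤ C :=
    ⟨_, BoundedContinuousFunction.NNReal.upper_bound g⟩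
  have hGC : ∀ x, G x ≤ C := fun x => by
    calc G x ≤ ∫⁻ _, C ∂(P x : Measure PathSp) := lintegral_mono fun Y => ENNReal.coe_le_coe.2 (hC Y)
      _ = C := by simp
  have heq : ∀ n, ∫⁻ X, g (pathShift (discTime K n X) X) ∂(P z : Measure PathSp) =
      ∫⁻ X, G (X (discTime K n X)) ∂(P z : Measure PathSp) := by
    intro n
    have hn : (0 : ℝ≥0) < (n : ℝ≥0) + 1 := by positivity
    set q : ℕ → ℝ≥0 := fun k => k / (n + 1) with hq
    set A : ℕ → Set PathSp :=
      fun k => {X | X ∈ hits K ∧ ⌈((n : ℝ≥0) + 1) * hitTime K X⌉₊ = k} with hAdef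
    have hiff : ∀ X ∈ hits K, ∀ k : ℕ,
        X ∈ hitsBy K (q k) ↔ ⌈((n : ℝ≥0) + 1) * hitTime K X⌉₊ ≤ k := fun X hX k => by
      rw [← hitTime_le_iff hK hX, Nat.ceil_le, hq, le_div_iff₀ hn, mul_comm]
    have hApast : ∀ k, MeasurableSet[pastAlg (q k)] (A k) := by
      intro k
      cases k with
      | zero =>
        have : A 0 = hitsBy K (q 0) := by
          ext X
          constructor
          · rintro ⟨hX, h⟩
            exact (hiff X hX 0).2 h.le
          · intro h
            have hX : X ∈ hits K := h.imp fun _ h => h.2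
            exact ⟨hX, Nat.le_zero.1 ((hiff X hX 0).1 h)⟩
        rw [this]
        exact measurableSet_pastAlg_hitsBy hK _
      | succ k =>
        have : A (k + 1) = hitsBy K (q (k + 1)) \ hitsBy K (q k) := by
          ext X
          constructor
          · rintro ⟨hX, h⟩
            refine ⟨(hiff X hX _).2 h.le, fun h' => ?_⟩
            have := (hiff X hX k).1 h'
            omega
          · rintro ⟨h, h'⟩
            have hX : X ∈ hits K := h.imp fun _ h => h.2
            rw [hiff X hX] at h h'
            exact ⟨hX, by omega⟩
        rw [this]
        refine (measurableSet_pastAlg_hitsBy hK _).diff ?_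
        have hle : pastAlg (q k) ≤ pastAlg (q (k + 1)) := by
          refine biSup_mono fun u hu => (Set.mem_Iic.1 hu).trans ?_
          simp only [hq]
          gcongr
          simp
        exact hle _ (measurableSet_pastAlg_hitsBy hK _)
    have hAm : ∀ k, MeasurableSet (A k) := fun k => pastAlg_le _ _ (hApast k)
    have hdisj : Pairwise (Function.onFun Disjoint A) := by
      intro i j hij
      refine Set.disjoint_left.2 fun X hi hj => hij ?_
      rw [← hi.2, hj.2]
    have hU : (P z : Measure PathSp).restrict (⋃ k, A k) = P z := by
      refine Measure.restrict_eq_self_of_ae_mem ?_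
      filter_upwards [hhit] with X hX
      exact Set.mem_iUnion.2 ⟨_, hX, rfl⟩
    conv_lhs => rw [← hU]
    conv_rhs => rw [← hU]
    rw [lintegral_iUnion hAm hdisj, lintegral_iUnion hAm hdisj]
    refine tsum_congr fun k => ?_
    have hqA : ∀ X ∈ A k, discTime K n X = q k := fun X hX => by
      rw [discTime, hX.2]
    have e1 : ∫⁻ X in A k, g (pathShift (discTime K n X) X) ∂(P z : Measure PathSp) =
        ∫⁻ X in A k, g (pathShift (q k) X) ∂(P z : Measure PathSp) :=
      setLIntegral_congr_fun (hAm k) fun X hX => by simp only [hqA X hX]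
    have e2 : ∫⁻ X in A k, G (X (discTime K n X)) ∂(P z : Measure PathSp) =
        ∫⁻ X in A k, G (X (q k)) ∂(P z : Measure PathSp) :=
      setLIntegral_congr_fun (hAm k) fun X hX => by simp only [hqA X hX]
    rw [e1, e2]
    exact hP.setLIntegral_eq hPc z (q k) (hApast k) hg
  have hl : Tendsto (fun n => ∫⁻ X, g (pathShift (discTime K n X) X) ∂(P z : Measure PathSp)) atTop
      (𝓝 (∫⁻ X, g (pathShift (hitTime K X) X) ∂(P z : Measure PathSp))) := by
    refine tendsto_lintegral_of_dominated_convergence (fun _ => (C : ℝ≥0∞)) (fun n => ?_)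
      (fun n => ae_of_all _ fun X => ENNReal.coe_le_coe.2 (hC _)) (by simp) (ae_of_all _ fun X => ?_)
    · exact hg.comp (continuous_pathShift_uncurry.measurable.comp ((hdisc n).prodMk measurable_id))
    · have h1 : Continuous fun t : ℝ≥0 => (g (pathShift t X) : ℝ≥0∞) :=
        ENNReal.continuous_coe.comp (g.continuous.comp
          (continuous_pathShift_uncurry.comp (Continuous.prodMk_left X)))
      exact (h1.tendsto _).comp (tendsto_discTime K X)
  have hr : Tendsto (fun n => ∫⁻ X, G (X (discTime K n X)) ∂(P z : Measure PathSp)) atTop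
      (𝓝 (∫⁻ X, G (hitPoint K X) ∂(P z : Measure PathSp))) := by
    refine tendsto_lintegral_of_dominated_convergence (fun _ => (C : ℝ≥0∞)) (fun n => ?_)
      (fun n => ae_of_all _ fun X => hGC _) (by simp) (ae_of_all _ fun X => ?_)
    · exact hGc.measurable.comp ((continuous_eval.measurable :
        Measurable fun p : PathSp × ℝ≥0 => p.1 p.2).comp (measurable_id.prodMk (hdisc n)))
    · exact ((hGc.comp X.continuous).tendsto _).comp (tendsto_discTime K X)
  simp only [heq] at hl
  exact tendsto_nhds_unique hl hr

end Markov

/-! ### Occupation times have zero-infinity laws independent of the starting point -/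

section Potential

variable {P : ℂ → ProbabilityMeasure PathSp} {B : Set ℂ}

/-- The expected occupation time of `B`, truncated at level `k`, as a function of the
starting point. -/
def truncPotential (P : ℂ → ProbabilityMeasure PathSp) (B : Set ℂ) (k : ℕ) (z : ℂ) : ℝ≥0∞ :=
  ∫⁻ X, min (occupation B X) k ∂(P z : Measure PathSp)

lemma measurable_min_occupation (hB : MeasurableSet B) (k : ℕ) :
    Measurable fun X => min (occupation B X) (k : ℝ≥0∞) :=
  (measurable_occupation hB).min measurable_const

lemma truncPotential_le (P : ℂ → ProbabilityMeasure PathSp) (B : Set ℂ) (k : ℕ) (z : ℂ) :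
    truncPotential P B k z ≤ k :=
  (lintegral_mono fun _ => min_le_right _ _).trans (by simp)

lemma lintegral_truncPotential_hitPoint_le (hPc : Continuous P) (hP : IsMarkovian P)
    (hB : MeasurableSet B) (k : ℕ) {D : Set ℂ} (hD : IsClosed D) {z : ℂ}
    (hhit : ∀ᵐ X ∂(P z : Measure PathSp), X ∈ hits D) :
    ∫⁻ X, truncPotential P B k (hitPoint D X) ∂(P z : Measure PathSp) ≤ truncPotential P B k z := by
  unfold truncPotential
  rw [← hP.lintegral_pathShift_hitTime hPc hD hhit (measurable_min_occupation hB k)]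
  exact lintegral_mono fun X => min_le_min_right _ (occupation_pathShift_le B _ X)

lemma truncPotential_le_add (hPc : Continuous P) (hP : IsMarkovian P)
    (hB : MeasurableSet B) (k : ℕ) {D : Set ℂ} (hD : IsClosed D) {z : ℂ}
    (hhit : ∀ᵐ X ∂(P z : Measure PathSp), X ∈ hits D) (ε : ℝ≥0) :
    truncPotential P B k z ≤ ε + k * (P z : Measure PathSp) (hitsBy D ε)ᶜ +
      ∫⁻ X, truncPotential P B k (hitPoint D X) ∂(P z : Measure PathSp) := by
  have hm := (measurableSet_hitsBy hD ε).compl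
  unfold truncPotential
  rw [← hP.lintegral_pathShift_hitTime hPc hD hhit (measurable_min_occupation hB k)]
  calc ∫⁻ X, min (occupation B X) k ∂(P z : Measure PathSp)
      ≤ ∫⁻ X, (ε + (hitsBy D ε)ᶜ.indicator (fun _ => (k : ℝ≥0∞)) X) +
          min (occupation B (pathShift (hitTime D X) X)) k ∂(P z : Measure PathSp) := by
        refine lintegral_mono_ae ?_
        filter_upwards [hhit] with X hX
        by_cases h : X ∈ hitsBy D ε
        · have ht := (hitTime_le_iff hD hX ε).2 h
          rw [Set.indicator_of_notMem (by simpa using h), add_zero]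
          calc min (occupation B X) (k : ℝ≥0∞)
              ≤ min (ε + occupation B (pathShift (hitTime D X) X)) (ε + k) := by
                refine min_le_min ((occupation_le_add B (hitTime D X) X).trans ?_) le_add_self
                gcongr
            _ = _ := min_add_add_left _ _ _
        · rw [Set.indicator_of_mem (by simpa using h)]
          exact (min_le_right _ _).trans (le_add_self.trans le_self_add)
    _ = _ := by
        have h1 : Measurable ((hitsBy D ε)ᶜ.indicator fun _ => (k : ℝ≥0∞)) :=
          measurable_const.indicator hm
        rw [lintegral_add_left (h1.const_add _), lintegral_add_left measurable_const,
          lintegral_indicator_const hm]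
        simp

/-- Truncated potentials are lower semicontinuous. -/
lemma exists_forall_truncPotential_le (hPc : Continuous P) (hP : IsMarkovian P)
    (hT : IsTimeChangedBM P) (hB : MeasurableSet B) (k : ℕ) (y : ℂ) {η : ℝ≥0∞} (hη : 0 < η) :
    ∃ r : ℝ, 0 < r ∧ ∀ x, dist x y < r → truncPotential P B k y ≤ truncPotential P B k x + η := by
  have hη2 : 0 < η / 2 := ENNReal.half_pos hη.ne'
  obtain ⟨ε, hε, hεη⟩ := ENNReal.lt_iff_exists_nnreal_btwn.1 hη2
  have hk : 0 < η / 2 / (k + 1 : ℕ) := ENNReal.div_pos hη2.ne' (ENNReal.natCast_ne_top _)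
  obtain ⟨r, hr, h⟩ := hT.exists_measure_compl_hitsBy_bisector_le y (ENNReal.coe_pos.1 hε) hk
  refine ⟨r, hr, fun x hx => ?_⟩
  rcases eq_or_ne x y with rfl | hxy
  · exact le_self_add
  have hLc := isClosed_bisector x y
  have hw : Measurable (truncPotential P B k) :=
    measurable_lintegral hPc (measurable_min_occupation hB k)
  have h1 := truncPotential_le_add hPc hP hB k hLc (hT.ae_hits_bisector y hxy) ε
  have h2 := lintegral_truncPotential_hitPoint_le hPc hP hB k hLc (hT.ae_hits_bisector x hxy)
  rw [← lintegral_map hw (measurable_hitPoint hLc)] at h1 h2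
  rw [hT.map_hitPoint_bisector_eq hxy] at h2
  have h3 : (k : ℝ≥0∞) * (P y : Measure PathSp) (hitsBy (bisector x y) ε)ᶜ ≤ η / 2 :=
    calc (k : ℝ≥0∞) * (P y : Measure PathSp) (hitsBy (bisector x y) ε)ᶜ
        ≤ (k + 1 : ℕ) * (η / 2 / (k + 1 : ℕ)) := by
          gcongr
          · exact Nat.le_succ k
          · exact h x hxy hx
      _ ≤ η / 2 := ENNReal.mul_div_le
  calc truncPotential P B k y ≤ _ := h1
    _ ≤ η / 2 + η / 2 + truncPotential P B k x := add_le_add (add_le_add hεη.le h3) h2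
    _ = truncPotential P B k x + η := by rw [ENNReal.add_halves, add_comm]

lemma truncPotential_eq (hPc : Continuous P) (hP : IsMarkovian P)
    (hT : IsTimeChangedBM P) (hB : MeasurableSet B) (k : ℕ) (x y : ℂ) :
    truncPotential P B k x = truncPotential P B k y := by
  have key : ∀ x y, truncPotential P B k y ≤ truncPotential P B k x := by
    intro x y
    refine ENNReal.le_of_forall_pos_le_add fun η hη _ => ?_
    obtain ⟨r, hr, h⟩ := exists_forall_truncPotential_le hPc hP hT hB k y (ENNReal.coe_pos.2 hη)
    have hD : IsClosed (Metric.closedBall y (r / 2)) := Metric.isClosed_closedBall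
    have hhit := hT.ae_hits x hD (Metric.measure_closedBall_pos _ _ (half_pos hr)).ne'
    calc truncPotential P B k y
        = ∫⁻ _, truncPotential P B k y ∂(P x : Measure PathSp) := by simp
      _ ≤ ∫⁻ X, truncPotential P B k (hitPoint (Metric.closedBall y (r / 2)) X) + η
            ∂(P x : Measure PathSp) := by
          refine lintegral_mono_ae ?_
          filter_upwards [hhit] with X hX
          exact h _ ((Metric.mem_closedBall.1 (hitPoint_mem hD hX)).trans_lt (half_lt_self hr))
      _ = ∫⁻ X, truncPotential P B k (hitPoint (Metric.closedBall y (r / 2)) X)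
            ∂(P x : Measure PathSp) + η := by
          rw [lintegral_add_right _ measurable_const]
          simp
      _ ≤ _ := by
          gcongr
          exact lintegral_truncPotential_hitPoint_le hPc hP hB k hD hhit
  exact (key y x).antisymm (key x y)

lemma ENNReal.eq_of_forall_min_natCast_eq {a b : ℝ≥0∞}
    (h : ∀ k : ℕ, min a (k : ℝ≥0∞) = min b k) : a = b := by
  have : ∀ {a b : ℝ≥0∞}, (∀ k : ℕ, min a (k : ℝ≥0∞) = min b k) → a ≤ b := by
    intro a b h
    refine le_of_forall_lt fun c hc => ?_
    obtain ⟨k, hk⟩ := ENNReal.exists_nat_gt (ne_top_of_lt hc)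
    have := lt_min hc hk
    rw [h k] at this
    exact this.trans_le (min_le_left _ _)
  exact (this h).antisymm (this fun k => (h k).symm)

/-- Almost surely, the occupation time of a measurable set is either zero or infinite. -/
lemma ae_occupation_eq_zero_or_top (hPc : Continuous P) (hP : IsMarkovian P)
    (hT : IsTimeChangedBM P) (hB : MeasurableSet B) (z : ℂ) :
    ∀ᵐ X ∂(P z : Measure PathSp), occupation B X = 0 ∨ occupation B X = ∞ := by
  have h : ∀ n k : ℕ, ∀ᵐ X ∂(P z : Measure PathSp),
      min (occupation B (pathShift n X)) (k : ℝ≥0∞) = min (occupation B X) k := by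
    intro n k
    have hm := measurable_min_occupation hB k
    have e : ∫⁻ X, min (occupation B (pathShift n X)) (k : ℝ≥0∞) ∂(P z : Measure PathSp) =
        truncPotential P B k z := by
      have := hP.setLIntegral_eq hPc z n MeasurableSet.univ hm
      rw [Measure.restrict_univ] at this
      rw [this]
      calc ∫⁻ X, truncPotential P B k (X n) ∂(P z : Measure PathSp)
          = ∫⁻ _, truncPotential P B k z ∂(P z : Measure PathSp) :=
            lintegral_congr fun X => truncPotential_eq hPc hP hT hB k _ _
        _ = _ := by simp
    refine ae_eq_of_ae_le_of_lintegral_le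
      (ae_of_all _ fun X => min_le_min_right _ (occupation_pathShift_le B n X)) ?_ hm.aemeasurable
      e.ge
    rw [e]
    exact ((truncPotential_le P B k z).trans_lt (ENNReal.natCast_lt_top k)).ne
  have h' := ae_all_iff.2 fun n => ae_all_iff.2 (h n)
  filter_upwards [h'] with X hX
  by_cases htop : occupation B X = ∞
  · exact Or.inr htop
  · exact Or.inl (occupation_eq_zero_of_pathShift
      (fun n => ENNReal.eq_of_forall_min_natCast_eq (hX n)) htop)

lemma measure_occupation_eq_top_eq (hPc : Continuous P) (hP : IsMarkovian P)
    (hT : IsTimeChangedBM P) (hB : MeasurableSet B) (x y : ℂ) :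
    (P x : Measure PathSp) {X | occupation B X = ∞} =
      (P y : Measure PathSp) {X | occupation B X = ∞} := by
  have hS : MeasurableSet {X : PathSp | occupation B X = ∞} :=
    measurable_occupation hB (measurableSet_singleton ∞)
  have h : ∀ z, truncPotential P B 1 z = (P z : Measure PathSp) {X | occupation B X = ∞} := by
    intro z
    rw [← lintegral_indicator_one hS]
    refine lintegral_congr_ae ?_
    filter_upwards [ae_occupation_eq_zero_or_top hPc hP hT hB z] with X hX
    rcases hX with hX | hX <;> simp [Set.indicator, hX]
  rw [← h, ← h]
  exact truncPotential_eq hPc hP hT hB 1 x y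

lemma occupation_univ (X : PathSp) : occupation Set.univ X = ∞ := by
  simp [occupation]

lemma occupation_iUnion_le (B : ℕ → Set ℂ) (hB : ∀ n, MeasurableSet (B n)) (X : PathSp) :
    occupation (⋃ n, B n) X ≤ ∑' n, occupation (B n) X := by
  unfold occupation
  have hm : ∀ n, Measurable fun t : ℝ => (B n).indicator (1 : ℂ → ℝ≥0∞) (X t.toNNReal) :=
    fun n => (measurable_indicator_eval (hB n)).comp measurable_prodMk_left
  rw [← lintegral_tsum fun n => (hm n).aemeasurable]
  refine lintegral_mono fun t => ?_
  by_cases h : X t.toNNReal ∈ ⋃ n, B n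
  · obtain ⟨n, hn⟩ := Set.mem_iUnion.1 h
    rw [Set.indicator_of_mem h]
    calc (1 : ℂ → ℝ≥0∞) (X t.toNNReal) = (B n).indicator 1 (X t.toNNReal) := by
          rw [Set.indicator_of_mem hn]
      _ ≤ _ := ENNReal.le_tsum (f := fun n => (B n).indicator (1 : ℂ → ℝ≥0∞) (X t.toNNReal)) n
  · rw [Set.indicator_of_notMem h]
    exact zero_le

/-- If countably many measurable sets cover the plane, then the occupation time of one of them
is infinite with positive probability from every starting point. -/
lemma exists_measure_occupation_eq_top_pos (hPc : Continuous P) (hP : IsMarkovian P)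
    (hT : IsTimeChangedBM P) {B : ℕ → Set ℂ} (hB : ∀ n, MeasurableSet (B n))
    (hU : ⋃ n, B n = Set.univ) :
    ∃ n, ∀ z, (P z : Measure PathSp) {X | occupation (B n) X = ∞} ≠ 0 := by
  by_contra! hcon
  have h0 : ∀ n, (P 0 : Measure PathSp) {X | occupation (B n) X = ∞} = 0 := fun n => by
    obtain ⟨z, hz⟩ := hcon n
    rw [measure_occupation_eq_top_eq hPc hP hT (hB n) 0 z, hz]
  have h1 : ∀ᵐ X ∂(P 0 : Measure PathSp), ∀ n, occupation (B n) X = 0 := by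
    refine ae_all_iff.2 fun n => ?_
    have h2 : ∀ᵐ X ∂(P 0 : Measure PathSp), ¬ occupation (B n) X = ∞ := by
      rw [ae_iff]
      simpa using h0 n
    filter_upwards [h2, ae_occupation_eq_zero_or_top hPc hP hT (hB n) 0] with X hX hX'
    exact hX'.resolve_right hX
  obtain ⟨X, hX⟩ := h1.exists
  have := occupation_iUnion_le B hB X
  rw [hU, occupation_univ] at this
  simp [hX] at this

end Potential

/-! ### The time spent in a set before a deterministic time -/

/-- The time spent by a path in `B` before time `R`. -/
def occupationUpTo (B : Set ℂ) (R : ℝ≥0) (X : PathSp) : ℝ≥0∞ :=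
  ∫⁻ t in Set.Ico (0 : ℝ) R, B.indicator 1 (X t.toNNReal)

lemma measurable_occupationUpTo {B : Set ℂ} (hB : MeasurableSet B) (R : ℝ≥0) :
    Measurable (occupationUpTo B R) :=
  (measurable_indicator_eval hB).lintegral_prod_right'

lemma occupationUpTo_le_add (B : Set ℂ) (s R : ℝ≥0) (X : PathSp) :
    occupationUpTo B R X ≤ occupationUpTo B s X + occupationUpTo B R (pathShift s X) := by
  have h1 : Set.Ico (0 : ℝ) R ⊆ Set.Ico (0 : ℝ) s ∪ Set.Ico (s : ℝ) (s + R) := by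
    intro t ht
    rcases lt_or_ge t s with h | h
    · exact Or.inl ⟨ht.1, h⟩
    · exact Or.inr ⟨h, ht.2.trans_le (le_add_of_nonneg_left s.coe_nonneg)⟩
  have h2 : occupationUpTo B R (pathShift s X) =
      ∫⁻ t in Set.Ico (s : ℝ) (s + R), B.indicator 1 (X t.toNNReal) := by
    have := (measurePreserving_add_left (volume : Measure ℝ) (s : ℝ)).setLIntegral_comp_preimage_emb
      (measurableEmbedding_addLeft (s : ℝ)) (fun t => B.indicator 1 (X t.toNNReal))
      (Set.Ico (s : ℝ) (s + R))
    rw [← this]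
    have h3 : (fun t : ℝ => (s : ℝ) + t) ⁻¹' Set.Ico (s : ℝ) (s + R) = Set.Ico 0 (R : ℝ) := by
      ext; simp
    rw [h3, occupationUpTo]
    refine setLIntegral_congr_fun measurableSet_Ico fun t ht => ?_
    rw [pathShift_apply, Real.toNNReal_add s.coe_nonneg ht.1, Real.toNNReal_coe]
  rw [h2]
  exact (lintegral_mono_set h1).trans (lintegral_union_le _ _ _)

lemma occupation_eq_iSup (B : Set ℂ) (X : PathSp) :
    occupation B X = ⨆ n : ℕ, occupationUpTo B n X := by
  have h : Set.Ici (0 : ℝ) = ⋃ n : ℕ, Set.Ico (0 : ℝ) (n : ℝ≥0) := by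
    ext t
    simp only [Set.mem_Ici, Set.mem_iUnion, Set.mem_Ico, NNReal.coe_natCast]
    exact ⟨fun ht => (exists_nat_gt t).imp fun n hn => ⟨ht, hn⟩, fun ⟨n, hn⟩ => hn.1⟩
  unfold occupation occupationUpTo
  rw [h, setLIntegral_iUnion_of_directed]
  refine Monotone.directed_le fun m n hmn => Set.Ico_subset_Ico_right ?_
  exact_mod_cast hmn

/-! ### Path laws with a general initial measure -/

section Laws

variable {P : ℂ → ProbabilityMeasure PathSp} {B : Set ℂ} {ν h : Measure ℂ}

/-- The family `P` as a Markov kernel. -/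
def pathKernel (hPc : Continuous P) : Kernel ℂ PathSp :=
  ⟨fun z => (P z : Measure PathSp), measurable_coe_of_continuous hPc⟩

instance (hPc : Continuous P) : IsMarkovKernel (pathKernel hPc) :=
  ⟨fun z => inferInstanceAs (IsProbabilityMeasure (P z : Measure PathSp))⟩

/-- The law of the path with initial measure `ν`. -/
def pathLaw (hPc : Continuous P) (ν : Measure ℂ) : Measure PathSp := ν.bind (pathKernel hPc)

instance (hPc : Continuous P) [SFinite ν] : SFinite (pathLaw hPc ν) :=
  inferInstanceAs (SFinite (ν.bind (pathKernel hPc)))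

lemma lintegral_pathLaw (hPc : Continuous P) (ν : Measure ℂ) {f : PathSp → ℝ≥0∞}
    (hf : Measurable f) :
    ∫⁻ X, f X ∂(pathLaw hPc ν) = ∫⁻ z, ∫⁻ X, f X ∂(P z : Measure PathSp) ∂ν :=
  Measure.lintegral_bind (pathKernel hPc).aemeasurable hf.aemeasurable

lemma pathLaw_apply (hPc : Continuous P) (ν : Measure ℂ) {S : Set PathSp}
    (hS : MeasurableSet S) : pathLaw hPc ν S = ∫⁻ z, (P z : Measure PathSp) S ∂ν :=
  Measure.bind_apply hS (pathKernel hPc).aemeasurable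

lemma pathLaw_add (hPc : Continuous P) (ν h : Measure ℂ) :
    pathLaw hPc (ν + h) = pathLaw hPc ν + pathLaw hPc h := by
  ext S hS
  simp [pathLaw_apply hPc _ hS]

lemma pathLaw_mono (hPc : Continuous P) (hle : ν ≤ h) : pathLaw hPc ν ≤ pathLaw hPc h := by
  refine Measure.le_iff.2 fun S hS => ?_
  rw [pathLaw_apply hPc _ hS, pathLaw_apply hPc _ hS]
  exact lintegral_mono' hle le_rfl

/-- The law at time `t` for the initial measure `ν`. -/
def lawAt (hPc : Continuous P) (ν : Measure ℂ) (t : ℝ≥0) : Measure ℂ :=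
  (pathLaw hPc ν).map fun X => X t

lemma lawAt_add (hPc : Continuous P) (ν h : Measure ℂ) (t : ℝ≥0) :
    lawAt hPc (ν + h) t = lawAt hPc ν t + lawAt hPc h t := by
  rw [lawAt, pathLaw_add, Measure.map_add _ _ (measurable_eval t)]
  rfl

lemma lawAt_mono (hPc : Continuous P) (hle : ν ≤ h) (t : ℝ≥0) : lawAt hPc ν t ≤ lawAt hPc h t :=
  Measure.map_mono (pathLaw_mono hPc hle) (measurable_eval t)

lemma invariantFor_iff (hPc : Continuous P) :
    InvariantFor P ν ↔ ∀ t, lawAt hPc ν t = ν := by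
  have key : ∀ (t : ℝ≥0) (A : Set ℂ), MeasurableSet A →
      lawAt hPc ν t A = ∫⁻ z, (P z : Measure PathSp) {X : PathSp | X t ∈ A} ∂ν := by
    intro t A hA
    rw [lawAt, Measure.map_apply (measurable_eval t) hA,
      pathLaw_apply hPc _ (measurable_eval t hA)]
    rfl
  constructor
  · intro hν t
    ext A hA
    rw [key t A hA, hν t A hA]
  · intro hν t A hA
    rw [← key t A hA, hν t]

lemma lintegral_pathShift_pathLaw (hPc : Continuous P) (hP : IsMarkovian P) (ν : Measure ℂ)
    (s : ℝ≥0) {f : PathSp → ℝ≥0∞} (hf : Measurable f) :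
    ∫⁻ X, f (pathShift s X) ∂(pathLaw hPc ν) = ∫⁻ X, f X ∂(pathLaw hPc (lawAt hPc ν s)) := by
  have hfs : Measurable fun X => f (pathShift s X) := hf.comp (measurable_pathShift s)
  have hg : Measurable fun X : PathSp => ∫⁻ Y, f Y ∂(P (X s) : Measure PathSp) :=
    (measurable_lintegral hPc hf).comp (measurable_eval s)
  rw [lintegral_pathLaw hPc _ hfs, lintegral_pathLaw hPc _ hf,
    lawAt, lintegral_map (measurable_lintegral hPc hf) (measurable_eval s),
    lintegral_pathLaw hPc _ hg]
  refine lintegral_congr fun z => ?_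
  simpa using hP.setLIntegral_eq hPc z s MeasurableSet.univ hf

lemma lintegral_setLIntegral_pathLaw (hPc : Continuous P) [SFinite ν] (hB : MeasurableSet B)
    (S : Set ℝ) :
    ∫⁻ X, (∫⁻ t in S, B.indicator 1 (X t.toNNReal)) ∂(pathLaw hPc ν) =
      ∫⁻ t in S, lawAt hPc ν t.toNNReal B := by
  rw [lintegral_lintegral_swap (measurable_indicator_eval hB).aemeasurable]
  refine lintegral_congr fun t => ?_
  rw [lawAt, ← lintegral_indicator_one hB,
    lintegral_map (measurable_one.indicator hB) (measurable_eval _)]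

lemma lintegral_occupationUpTo_le (hPc : Continuous P) [SFinite h]
    (hle : ∀ t, lawAt hPc h t ≤ h) (hB : MeasurableSet B) (R : ℝ≥0) :
    ∫⁻ X, occupationUpTo B R X ∂(pathLaw hPc h) ≤ R * h B := by
  unfold occupationUpTo
  rw [lintegral_setLIntegral_pathLaw hPc hB]
  calc ∫⁻ t in Set.Ico (0 : ℝ) R, lawAt hPc h t.toNNReal B
      ≤ ∫⁻ _ in Set.Ico (0 : ℝ) R, h B := lintegral_mono fun t => hle _ B
    _ = R * h B := by simp [mul_comm]

lemma pathLaw_occupation_eq_top (hPc : Continuous P) (hP : IsMarkovian P)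
    (hT : IsTimeChangedBM P) (hB : MeasurableSet B) (ν : Measure ℂ) :
    pathLaw hPc ν {X | occupation B X = ∞} =
      (P 0 : Measure PathSp) {X | occupation B X = ∞} * ν Set.univ := by
  have hS : MeasurableSet {X : PathSp | occupation B X = ∞} :=
    measurable_occupation hB (measurableSet_singleton ∞)
  rw [pathLaw_apply hPc ν hS]
  simp_rw [fun z => measure_occupation_eq_top_eq hPc hP hT hB z 0]
  rw [lintegral_const]

lemma measure_eq_zero_of_lintegral_occupation_ne_top (hPc : Continuous P) (hP : IsMarkovian P)
    (hT : IsTimeChangedBM P) (hB : MeasurableSet B)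
    (hB0 : (P 0 : Measure PathSp) {X | occupation B X = ∞} ≠ 0)
    (hfin : ∫⁻ X, occupation B X ∂(pathLaw hPc ν) ≠ ∞) : ν = 0 := by
  have h1 := pathLaw_occupation_eq_top hPc hP hT hB ν
  have h2 := ae_lt_top (measurable_occupation hB) hfin
  rw [ae_iff] at h2
  simp only [not_lt, top_le_iff] at h2
  rw [h2, eq_comm, mul_eq_zero] at h1
  exact Measure.measure_univ_eq_zero.1 (h1.resolve_left hB0)

end Laws

/-! ### Excessive measures are invariant -/

section Excessive

lemma exists_add_eq_of_le {α : Type*} [MeasurableSpace α] {ν h : Measure α} [SigmaFinite h]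
    (hle : ν ≤ h) : ∃ δ : Measure α, h = ν + δ := by
  have : SigmaFinite ν := Measure.sigmaFinite_of_le h hle
  refine ⟨h.withDensity (1 - ν.rnDeriv h), ?_⟩
  conv_rhs => lhs; rw [← Measure.withDensity_rnDeriv_eq ν h (Measure.absolutelyContinuous_of_le hle)]
  rw [← withDensity_add_left (Measure.measurable_rnDeriv ν h)]
  conv_lhs => rw [← withDensity_one (μ := h)]
  refine withDensity_congr_ae ?_
  filter_upwards [Measure.rnDeriv_le_one_of_le hle] with x hx
  exact (add_tsub_cancel_of_le hx).symm

variable {P : ℂ → ProbabilityMeasure PathSp} {ν h : Measure ℂ}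

lemma invariantFor_of_lawAt_le (hPc : Continuous P) (hP : IsMarkovian P)
    (hT : IsTimeChangedBM P) [SigmaFinite h] (hle : ∀ t, lawAt hPc h t ≤ h) :
    InvariantFor P h := by
  refine (invariantFor_iff hPc).2 fun s => ?_
  obtain ⟨δ, hδ⟩ := exists_add_eq_of_le (hle s)
  obtain ⟨n, hn⟩ := exists_measure_occupation_eq_top_pos hPc hP hT
    (measurableSet_spanningSets h) (iUnion_spanningSets h)
  set B := spanningSets h n
  have hB : MeasurableSet B := measurableSet_spanningSets h n
  have hBfin : h B < ∞ := measure_spanningSets_lt_top h n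
  have hbound : ∀ R : ℝ≥0, ∫⁻ X, occupationUpTo B R X ∂(pathLaw hPc δ) ≤ s * h B := by
    intro R
    have hm := measurable_occupationUpTo hB R
    set I := ∫⁻ X, occupationUpTo B R (pathShift s X) ∂(pathLaw hPc h) with hI
    have e1 : ∫⁻ X, occupationUpTo B R X ∂(pathLaw hPc h) =
        I + ∫⁻ X, occupationUpTo B R X ∂(pathLaw hPc δ) := by
      rw [hI, lintegral_pathShift_pathLaw hPc hP h s hm]
      conv_lhs => rw [hδ, pathLaw_add, lintegral_add_measure]
    have e2 : ∫⁻ X, occupationUpTo B R X ∂(pathLaw hPc h) ≤ I + s * h B :=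
      calc ∫⁻ X, occupationUpTo B R X ∂(pathLaw hPc h)
          ≤ ∫⁻ X, occupationUpTo B s X + occupationUpTo B R (pathShift s X) ∂(pathLaw hPc h) :=
            lintegral_mono fun X => occupationUpTo_le_add B s R X
        _ = ∫⁻ X, occupationUpTo B s X ∂(pathLaw hPc h) + I :=
            lintegral_add_left (measurable_occupationUpTo hB s) _
        _ ≤ s * h B + I := by
            gcongr
            exact lintegral_occupationUpTo_le hPc hle hB s
        _ = I + s * h B := add_comm _ _
    have hItop : I ≠ ∞ := by
      have : I ≤ R * h B := (le_self_add.trans e1.ge).trans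
        (lintegral_occupationUpTo_le hPc hle hB R)
      exact (this.trans_lt (ENNReal.mul_lt_top ENNReal.coe_lt_top hBfin)).ne
    exact (ENNReal.add_le_add_iff_left hItop).1 (e1 ▸ e2)
  have hδ0 : δ = 0 := by
    refine measure_eq_zero_of_lintegral_occupation_ne_top hPc hP hT hB (hn 0) ?_
    simp_rw [occupation_eq_iSup]
    rw [lintegral_iSup (fun n => measurable_occupationUpTo hB n)]
    · exact ((iSup_le fun n : ℕ => hbound n).trans_lt
        (ENNReal.mul_lt_top ENNReal.coe_lt_top hBfin)).ne
    · intro m n hmn X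
      refine lintegral_mono_set (Set.Ico_subset_Ico_right ?_)
      exact_mod_cast hmn
  rw [hδ0, add_zero] at hδ
  exact hδ.symm

lemma InvariantFor.eq_zero_or_eq_zero_of_mutuallySingular {ν₁ ν₂ : Measure ℂ}
    (hPc : Continuous P) (hP : IsMarkovian P) (hT : IsTimeChangedBM P)
    [SigmaFinite ν₁] [SigmaFinite ν₂] (h₁ : InvariantFor P ν₁) (h₂ : InvariantFor P ν₂)
    (hs : ν₁ ⟂ₘ ν₂) : ν₁ = 0 ∨ ν₂ = 0 := by
  have key : ∀ {ν : Measure ℂ} [SigmaFinite ν] {A : Set ℂ}, InvariantFor P ν → MeasurableSet A →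
      ν A = 0 → (P 0 : Measure PathSp) {X | occupation A X = ∞} ≠ 0 → ν = 0 := by
    intro ν _ A hν hA hνA hA0
    refine measure_eq_zero_of_lintegral_occupation_ne_top hPc hP hT hA hA0 ?_
    unfold occupation
    rw [lintegral_setLIntegral_pathLaw hPc hA]
    simp [(invariantFor_iff hPc).1 hν, hνA]
  obtain ⟨A, hA, hA₁, hA₂⟩ := hs
  obtain ⟨n, hn⟩ := exists_measure_occupation_eq_top_pos hPc hP hT
    (B := fun n => if n = 0 then A else Aᶜ)
    (fun n => by by_cases hn : n = 0 <;> simp [hn, hA])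
    (by
      refine Set.eq_univ_of_forall fun z => Set.mem_iUnion.2 ?_
      by_cases hz : z ∈ A
      · exact ⟨0, by simpa using hz⟩
      · exact ⟨1, by simpa using hz⟩)
  by_cases h0 : n = 0
  · exact Or.inl (key h₁ hA hA₁ (by simpa [h0] using hn 0))
  · exact Or.inr (key h₂ hA.compl hA₂ (by simpa [h0] using hn 0))

/-- Any two σ-finite invariant measures are comparable. -/
lemma InvariantFor.le_total {ν₁ ν₂ : Measure ℂ}
    (hPc : Continuous P) (hP : IsMarkovian P) (hT : IsTimeChangedBM P)
    [SigmaFinite ν₁] [SigmaFinite ν₂] (h₁ : InvariantFor P ν₁) (h₂ : InvariantFor P ν₂) :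
    ν₁ ≤ ν₂ ∨ ν₂ ≤ ν₁ := by
  rw [invariantFor_iff hPc] at h₁ h₂
  have : SigmaFinite (ν₁ ⊓ ν₂) := Measure.sigmaFinite_of_le ν₁ inf_le_left
  have hinv : ∀ t, lawAt hPc (ν₁ ⊓ ν₂) t = ν₁ ⊓ ν₂ := by
    refine (invariantFor_iff hPc).1 (invariantFor_of_lawAt_le hPc hP hT fun t => le_inf ?_ ?_)
    · exact (lawAt_mono hPc inf_le_left t).trans (h₁ t).le
    · exact (lawAt_mono hPc inf_le_right t).trans (h₂ t).le
  obtain ⟨σ₁, hσ₁⟩ := exists_add_eq_of_le (inf_le_left : ν₁ ⊓ ν₂ ≤ ν₁)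
  obtain ⟨σ₂, hσ₂⟩ := exists_add_eq_of_le (inf_le_right : ν₁ ⊓ ν₂ ≤ ν₂)
  have hrem : ∀ {ν σ : Measure ℂ}, (∀ t, lawAt hPc ν t = ν) → ν = ν₁ ⊓ ν₂ + σ →
      InvariantFor P σ := by
    intro ν σ hν hσ
    refine (invariantFor_iff hPc).2 fun t => ?_
    have := hν t
    rw [hσ, lawAt_add, hinv t] at this
    exact (Measure.add_right_inj _ _ _).1 this
  have : SigmaFinite σ₁ := Measure.sigmaFinite_of_le ν₁ (hσ₁ ▸ Measure.le_add_left le_rfl)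
  have : SigmaFinite σ₂ := Measure.sigmaFinite_of_le ν₂ (hσ₂ ▸ Measure.le_add_left le_rfl)
  have hsing : σ₁ ⟂ₘ σ₂ := by
    rw [Measure.mutuallySingular_iff_disjoint, disjoint_iff]
    have hk : ν₁ ⊓ ν₂ + σ₁ ⊓ σ₂ ≤ ν₁ ⊓ ν₂ := by
      refine le_inf ?_ ?_
      · conv_rhs => rw [hσ₁]
        gcongr
        exact inf_le_left
      · conv_rhs => rw [hσ₂]
        gcongr
        exact inf_le_right
    refine (Measure.add_right_inj (ν₁ ⊓ ν₂) _ 0).1 ?_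
    rw [add_zero]
    exact hk.antisymm (Measure.le_add_right le_rfl)
  rcases (hrem h₁ hσ₁).eq_zero_or_eq_zero_of_mutuallySingular hPc hP hT (hrem h₂ hσ₂) hsing
    with h0 | h0
  · rw [h0, add_zero] at hσ₁
    exact Or.inl (hσ₁.le.trans inf_le_right)
  · rw [h0, add_zero] at hσ₂
    exact Or.inr (hσ₂.le.trans inf_le_left)

lemma InvariantFor.smul (hν : InvariantFor P ν) (c : ℝ≥0) : InvariantFor P (c • ν) := by
  intro t A hA
  rw [lintegral_smul_measure, hν t A hA, Measure.smul_apply]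

end Excessive

lemma exists_measure_pos_lt_top_of_le {α : Type*} [MeasurableSpace α] {μ₁ μ₂ : Measure α}
    [SigmaFinite μ₂] (h : μ₁ ≤ μ₂) (h₁ : μ₁ ≠ 0) :
    ∃ B, 0 < μ₁ B ∧ μ₁ B < ∞ ∧ 0 < μ₂ B ∧ μ₂ B < ∞ := by
  obtain ⟨n, hn⟩ : ∃ n, μ₁ (spanningSets μ₂ n) ≠ 0 := by
    by_contra! hcon
    refine h₁ (Measure.measure_univ_eq_zero.1 ?_)
    rw [← iUnion_spanningSets μ₂]
    exact measure_iUnion_null hcon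
  have h2 := measure_spanningSets_lt_top μ₂ n
  exact ⟨_, pos_iff_ne_zero.2 hn, (h _).trans_lt h2, (pos_iff_ne_zero.2 hn).trans_le (h _), h2⟩

/-- Two measures all of whose multiples are comparable are proportional. -/
lemma exists_eq_smul_of_le_total {α : Type*} [MeasurableSpace α] {μ₁ μ₂ : Measure α}
    [SigmaFinite μ₁] [SigmaFinite μ₂] (h₁ : μ₁ ≠ 0) (h₂ : μ₂ ≠ 0)
    (h : ∀ c : ℝ≥0, μ₁ ≤ c • μ₂ ∨ c • μ₂ ≤ μ₁) : ∃ c : ℝ≥0, 0 < c ∧ μ₁ = c • μ₂ := by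
  obtain ⟨B, h1, h1', h2, h2'⟩ : ∃ B, 0 < μ₁ B ∧ μ₁ B < ∞ ∧ 0 < μ₂ B ∧ μ₂ B < ∞ := by
    rcases h 1 with hle | hle
    · exact exists_measure_pos_lt_top_of_le (by simpa using hle) h₁
    · obtain ⟨B, hB⟩ := exists_measure_pos_lt_top_of_le (by simpa using hle) h₂
      exact ⟨B, hB.2.2.1, hB.2.2.2, hB.1, hB.2.1⟩
  obtain ⟨c, hc⟩ : ∃ c : ℝ≥0, (c : ℝ≥0∞) = μ₁ B / μ₂ B :=
    ⟨_, ENNReal.coe_toNNReal (ENNReal.div_lt_top h1'.ne h2.ne').ne⟩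
  have hc0 : 0 < c := by
    rw [← ENNReal.coe_pos, hc]
    exact ENNReal.div_pos h1.ne' h2'.ne
  have hcB : c * μ₂ B = μ₁ B := by
    rw [hc, ENNReal.div_mul_cancel h2.ne' h2'.ne]
  refine ⟨c, hc0, le_antisymm ?_ ?_⟩
  all_goals refine Measure.le_iff.2 fun A _ => ?_
  · have ht : Tendsto (fun d : ℝ≥0 => (d : ℝ≥0∞) * μ₂ A) (𝓝[>] c) (𝓝 (c * μ₂ A)) :=
      (ENNReal.Tendsto.mul_const (ENNReal.continuous_coe.tendsto c)
        (Or.inl (by simpa using hc0.ne'))).mono_left nhdsWithin_le_nhds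
    refine ge_of_tendsto ht ?_
    filter_upwards [self_mem_nhdsWithin] with d hd
    refine (h d).elim (fun hle => hle A) fun hle => absurd (hle B) (not_le.2 ?_)
    rw [← hcB, Measure.smul_apply, ENNReal.smul_def, smul_eq_mul]
    exact ENNReal.mul_lt_mul_left h2.ne' h2'.ne (ENNReal.coe_lt_coe.2 hd)
  · have ht : Tendsto (fun d : ℝ≥0 => (d : ℝ≥0∞) * μ₂ A) (𝓝[<] c) (𝓝 (c * μ₂ A)) :=
      (ENNReal.Tendsto.mul_const (ENNReal.continuous_coe.tendsto c)
        (Or.inl (by simpa using hc0.ne'))).mono_left nhdsWithin_le_nhds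
    have : (𝓝[<] c).NeBot := nhdsLT_neBot_of_exists_lt ⟨0, hc0⟩
    refine le_of_tendsto ht ?_
    filter_upwards [self_mem_nhdsWithin] with d hd
    refine (h d).elim (fun hle => absurd (hle B) (not_le.2 ?_)) fun hle => hle A
    rw [← hcB, Measure.smul_apply, ENNReal.smul_def, smul_eq_mul]
    exact ENNReal.mul_lt_mul_left h2.ne' h2'.ne (ENNReal.coe_lt_coe.2 hd)

theorem stmt15 (P : ℂ → ProbabilityMeasure PathSp) (hPc : Continuous P)
    (hP : DefinesMTCBM P)
    (μ₁ μ₂ : Measure ℂ) [SigmaFinite μ₁] [SigmaFinite μ₂]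
    (h₁ : μ₁ ≠ 0) (h₂ : μ₂ ≠ 0)
    (hinv₁ : InvariantFor P μ₁) (hinv₂ : InvariantFor P μ₂) :
    ∃ c : ℝ≥0, 0 < c ∧ μ₁ = c • μ₂ :=
  exists_eq_smul_of_le_total h₁ h₂ fun c => hinv₁.le_total hPc hP.2.1 hP.2.2 (hinv₂.smul c)
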